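/- For every ε > 0 there exists a constant C = C(ε) such that for all real X ≥ 2 and all real Z with X^{1/6} ≤ Z ≤ X, the sum of S_3(d;Z)² over squarefree integers d with X ≤ d < 2X is at most C · X^ε · ( Z² X^{1/2} + Z^{12} X^{-3/2} ). -/

import Mathlib

/-- `Sg g d Z` is the number of ordered pairs `(p, p')` of distinct primes with
`Z ≤ p, p' < 2Z` for which there exist nonzero integers `u, v` with
`gcd(v, p·p') = 1` and `4(p·p')^g = u² + d·v²`. -/
noncomputable def Sg (g d : ℕ) (Z : ℝ) : ℕ :=
  Nat.card {pq : ℕ × ℕ // pq.1.Prime ∧ pq.2.Prime ∧ pq.1 ≠ pq.2 ∧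
    Z ≤ pq.1 ∧ (pq.1 : ℝ) < 2 * Z ∧ Z ≤ pq.2 ∧ (pq.2 : ℝ) < 2 * Z ∧
    ∃ u v : ℤ, u ≠ 0 ∧ v ≠ 0 ∧ Int.gcd v ((pq.1 : ℤ) * pq.2) = 1 ∧
      4 * ((pq.1 : ℤ) * pq.2) ^ g = u ^ 2 + (d : ℤ) * v ^ 2}

/-- The divisor bound `τ(n) ≪ n ^ δ`. -/
theorem exists_card_divisors_le_rpow (δ : ℝ) (hδ : 0 < δ) :
    ∃ C : ℝ, 1 ≤ C ∧ ∀ n : ℕ, n ≠ 0 → (n.divisors.card : ℝ) ≤ C * (n : ℝ) ^ δ := by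
  have hl2 : 0 < Real.log 2 := Real.log_pos one_lt_two
  set c : ℝ := 1 + 1 / (δ * Real.log 2) with hc
  have hc1 : 1 ≤ c := by
    have : 0 < 1 / (δ * Real.log 2) := by positivity
    linarith
  set N : ℕ := ⌈(2 : ℝ) ^ (1 / δ)⌉₊ with hN
  have hsmall : ∀ p k : ℕ, 2 ≤ p → (k + 1 : ℝ) ≤ c * ((p : ℝ) ^ k) ^ δ := by
    intro p k hp
    have hp' : (2 : ℝ) ≤ p := by exact_mod_cast hp
    have h1 : (2 : ℝ) ^ (k * δ) ≤ ((p : ℝ) ^ k) ^ δ := by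
      rw [Real.rpow_mul (by norm_num), Real.rpow_natCast]
      exact Real.rpow_le_rpow (by positivity) (pow_le_pow_left₀ (by norm_num) hp' k) hδ.le
    have h2 : 1 + Real.log 2 * (k * δ) ≤ (2 : ℝ) ^ (k * δ) := by
      rw [Real.rpow_def_of_pos (by norm_num)]
      linarith [Real.add_one_le_exp (Real.log 2 * (k * δ))]
    have h3 : (k + 1 : ℝ) ≤ c * (1 + Real.log 2 * (k * δ)) := by
      have : c * (1 + Real.log 2 * (k * δ))
          = 1 + k + Real.log 2 * (k * δ) + 1 / (δ * Real.log 2) := by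
        rw [hc]; field_simp; ring
      rw [this]
      have : 0 ≤ Real.log 2 * (k * δ) + 1 / (δ * Real.log 2) := by positivity
      linarith
    exact h3.trans (mul_le_mul_of_nonneg_left (h2.trans h1) (by linarith))
  have hlarge : ∀ p k : ℕ, N ≤ p → (k + 1 : ℝ) ≤ ((p : ℝ) ^ k) ^ δ := by
    intro p k hp
    have hp' : (2 : ℝ) ^ (1 / δ) ≤ p := (Nat.le_ceil _).trans (by exact_mod_cast hp)
    have h1 : (2 : ℝ) ≤ (p : ℝ) ^ δ := by
      have := Real.rpow_le_rpow (by positivity) hp' hδ.le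
      rwa [← Real.rpow_mul (by norm_num), one_div_mul_cancel hδ.ne', Real.rpow_one] at this
    have h2 : ((p : ℝ) ^ k) ^ δ = ((p : ℝ) ^ δ) ^ k := by
      rw [← Real.rpow_natCast, ← Real.rpow_natCast, ← Real.rpow_mul (by positivity),
        ← Real.rpow_mul (by positivity), mul_comm]
    rw [h2]
    calc (k + 1 : ℝ) ≤ 2 ^ k := by exact_mod_cast Nat.lt_two_pow_self (n := k)
      _ ≤ _ := pow_le_pow_left₀ (by norm_num) h1 k
  refine ⟨c ^ N, one_le_pow₀ hc1, fun n hn => ?_⟩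
  rw [Nat.card_divisors hn]
  have hfac : (n : ℝ) ^ δ = ∏ p ∈ n.primeFactors, ((p : ℝ) ^ (n.factorization p)) ^ δ := by
    rw [Real.finsetProd_rpow _ _ (fun i _ => by positivity)]
    congr 1
    exact_mod_cast (Nat.prod_factorization_pow_eq_self hn).symm
  rw [hfac]
  push_cast
  calc ∏ p ∈ n.primeFactors, ((n.factorization p : ℝ) + 1)
      ≤ ∏ p ∈ n.primeFactors, ((if p < N then c else 1) *
          ((p : ℝ) ^ (n.factorization p)) ^ δ) := by
        refine Finset.prod_le_prod (fun p _ => by positivity) fun p hp => ?_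
        split_ifs with h
        · exact hsmall p _ (Nat.prime_of_mem_primeFactors hp).two_le
        · rw [one_mul]; exact hlarge p _ (not_lt.mp h)
    _ = (∏ p ∈ n.primeFactors, (if p < N then c else 1)) *
          ∏ p ∈ n.primeFactors, ((p : ℝ) ^ (n.factorization p)) ^ δ := Finset.prod_mul_distrib
    _ ≤ _ := by
        refine mul_le_mul_of_nonneg_right ?_ (Finset.prod_nonneg fun p _ => by positivity)
        rw [← Finset.prod_filter, Finset.prod_const]
        refine pow_le_pow_right₀ hc1 ?_
        calc _ ≤ (Finset.range N).card := Finset.card_le_card fun p hp => by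
              simpa using (Finset.mem_filter.mp hp).2
          _ = N := Finset.card_range N

theorem Int.dvd_gcd_mul_of_dvd_mul {m a b : ℤ} (h : m ∣ a * b) : m ∣ (Int.gcd m a : ℤ) * b := by
  have := _root_.dvd_gcd_mul_of_dvd_mul h
  rwa [← Int.coe_gcd] at this

/-- One factorisation step in the study of `x ^ 3 ≡ x₀ ^ 3`: the root of the quadratic part. -/
theorem dvd_mul_sub_of_quadratic {f x y z x₀ : ℤ} (hf : f ≠ 0) (hx₀ : IsCoprime x₀ f)
    (hx : f ∣ 16 * (x ^ 2 + x * x₀ + x₀ ^ 2)) (hy : f ∣ 16 * (y ^ 2 + y * x₀ + x₀ ^ 2))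
    (hz : f ∣ 16 * (z ^ 2 + z * x₀ + x₀ ^ 2)) (hxy : Int.gcd f (x - z) = Int.gcd f (y - z)) :
    f ∣ 48 * (x - y) := by
  set e : ℤ := (Int.gcd f (x - z) : ℤ) with he
  have he0 : e ≠ 0 := by
    rw [he]; exact_mod_cast (Int.gcd_pos_of_ne_zero_left _ hf).ne'
  obtain ⟨f', hf'⟩ : e ∣ f := Int.gcd_dvd_left _ _
  have hex : e ∣ x - z := Int.gcd_dvd_right _ _
  have hey : e ∣ y - z := by rw [he, hxy]; exact Int.gcd_dvd_right _ _
  have heδ : e ∣ x - y := by simpa using dvd_sub hex hey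
  have key : ∀ w : ℤ, f ∣ 16 * (w ^ 2 + w * x₀ + x₀ ^ 2) → (Int.gcd f (w - z) : ℤ) = e →
      f' ∣ 16 * (w + z + x₀) := by
    intro w hw hwe
    have h1 : f ∣ (w - z) * (16 * (w + z + x₀)) := by
      have := dvd_sub hw hz
      exact this.trans (dvd_of_eq (by ring))
    have h2 := Int.dvd_gcd_mul_of_dvd_mul h1
    rw [hwe, hf'] at h2
    exact (mul_dvd_mul_iff_left he0).mp h2
  have hgx := key x hx rfl
  have hgy := key y hy (by rw [← hxy])
  have hfδ : f' ∣ 16 * (x - y) := by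
    have := dvd_sub hgx hgy
    exact this.trans (dvd_of_eq (by ring))
  have h1 : f ∣ (16 * (x + z + x₀)) * (x - y) := by
    rw [hf', mul_comm e]; exact mul_dvd_mul hgx heδ
  have h2 : f ∣ (x - z) * (16 * (x - y)) := by
    rw [hf']; exact mul_dvd_mul hex hfδ
  have h3 : f ∣ x₀ ^ 2 * (48 * (x - y)) := by
    have := dvd_sub (hz.mul_right (4 * (x - y)))
      ((dvd_sub h1 h2).mul_right (2 * z + x₀))
    exact this.trans (dvd_of_eq (by ring))
  exact (hx₀.symm.pow_right).dvd_of_dvd_mul_left h3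

/-- Cube roots modulo `m` can be coloured by few colours such that roots of the same colour agree
up to a bounded factor. -/
theorem exists_coloring_of_cubes (m : ℕ) (hm : m ≠ 0) (S : Set ℤ)
    (hcop : ∀ x ∈ S, IsCoprime x (m : ℤ))
    (hS : ∀ x ∈ S, ∀ y ∈ S, (m : ℤ) ∣ 16 * (x ^ 3 - y ^ 3)) :
    ∃ f : ℤ → ℕ × ℕ, (∀ x, f x ∈ m.divisors ×ˢ m.divisors) ∧
      ∀ x ∈ S, ∀ y ∈ S, f x = f y → (m : ℤ) ∣ 2304 * (x - y) := by
  classical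
  rcases S.eq_empty_or_nonempty with rfl | ⟨x₀, hx₀⟩
  · exact ⟨fun _ => (1, 1), by simp [hm], by simp⟩
  have hm' : (m : ℤ) ≠ 0 := by exact_mod_cast hm
  let e : ℤ → ℕ := fun x => Int.gcd m (x - x₀)
  have hb : ∀ k : ℕ, ∃ z : ℤ, (∃ x ∈ S, e x = k) → z ∈ S ∧ e z = k := by
    intro k
    by_cases h : ∃ x ∈ S, e x = k
    · obtain ⟨x, hx⟩ := h; exact ⟨x, fun _ => hx⟩
    · exact ⟨0, fun h' => absurd h' h⟩
  choose b hb using hb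
  have hem : ∀ x, e x ∣ m := fun x => by
    have : (e x : ℤ) ∣ m := Int.gcd_dvd_left _ _
    exact_mod_cast this
  refine ⟨fun x => (e x, Int.gcd ((m / e x : ℕ) : ℤ) (x - b (e x))), fun x => ?_, ?_⟩
  · simp only [Finset.mem_product, Nat.mem_divisors]
    refine ⟨⟨hem x, hm⟩, ?_, hm⟩
    have : (Int.gcd ((m / e x : ℕ) : ℤ) (x - b (e x)) : ℤ) ∣ ((m / e x : ℕ) : ℤ) :=
      Int.gcd_dvd_left _ _
    exact (Int.natCast_dvd_natCast.mp this).trans (Nat.div_dvd_of_dvd (hem x))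
  intro x hx y hy hxy
  simp only [Prod.mk.injEq] at hxy
  obtain ⟨h1, h2⟩ := hxy
  obtain ⟨hzS, hze⟩ := hb (e x) ⟨x, hx, rfl⟩
  rw [← h1] at h2
  set z := b (e x)
  set E : ℤ := (e x : ℤ) with hE
  set F : ℤ := ((m / e x : ℕ) : ℤ) with hF
  have hEF : (m : ℤ) = E * F := by
    rw [hE, hF]; exact_mod_cast (Nat.mul_div_cancel' (hem x)).symm
  have hE0 : E ≠ 0 := by rintro h; rw [h, zero_mul] at hEF; exact hm' hEF
  have hF0 : F ≠ 0 := by rintro h; rw [h, mul_zero] at hEF; exact hm' hEF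
  have key : ∀ w ∈ S, e w = e x → F ∣ 16 * (w ^ 2 + w * x₀ + x₀ ^ 2) := by
    intro w hw hwe
    have h3 : (m : ℤ) ∣ (w - x₀) * (16 * (w ^ 2 + w * x₀ + x₀ ^ 2)) := by
      have := hS w hw x₀ hx₀
      exact this.trans (dvd_of_eq (by ring))
    have h4 := Int.dvd_gcd_mul_of_dvd_mul h3
    have h5 : (Int.gcd (m : ℤ) (w - x₀) : ℤ) = E := by rw [hE, ← hwe]
    rw [h5, hEF] at h4
    exact (mul_dvd_mul_iff_left hE0).mp h4
  have hcF : IsCoprime x₀ F := (hcop x₀ hx₀).of_isCoprime_of_dvd_right ⟨E, by rw [hEF]; ring⟩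
  have hFδ : F ∣ 48 * (x - y) :=
    dvd_mul_sub_of_quadratic hF0 hcF (key x hx rfl) (key y hy h1.symm) (key z hzS hze) h2
  have hEx : E ∣ x - x₀ := Int.gcd_dvd_right _ _
  have hEy : E ∣ y - x₀ := by rw [hE, h1]; exact Int.gcd_dvd_right _ _
  have hEδ : E ∣ x - y := by simpa using dvd_sub hEx hEy
  have h3 : (m : ℤ) ∣ (x - y) * (16 * (x ^ 2 + x * x₀ + x₀ ^ 2)) := by
    rw [hEF]; exact mul_dvd_mul hEδ (key x hx rfl)
  have h4 : (m : ℤ) ∣ (x - x₀) * (48 * (x - y)) := by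
    rw [hEF]; exact mul_dvd_mul hEx hFδ
  have h5 : (m : ℤ) ∣ x₀ ^ 2 * (2304 * (x - y)) := by
    have := dvd_sub (h3.mul_right 48) (h4.mul_right (16 * (x + 2 * x₀)))
    exact this.trans (dvd_of_eq (by ring))
  exact ((hcop x₀ hx₀).symm.pow_right).dvd_of_dvd_mul_left h5

/-- `n₁ ^ 3` and `n₂ ^ 3` are simultaneously represented as `4 n ^ 3 = u ^ 2 + e w ^ 2` with the
same `e` and the given coprime values `w₁, w₂`; the integer `a` is `u₁ w₂ - u₂ w₁`. -/
def IsPairRep (n₁ n₂ w₁ w₂ : ℕ) (a : ℤ) : Prop :=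
  0 < w₁ ∧ 0 < w₂ ∧ w₁.Coprime w₂ ∧ w₁.Coprime n₁ ∧ w₂.Coprime n₂ ∧
    ∃ u₁ u₂ e : ℕ, 4 * n₁ ^ 3 = u₁ ^ 2 + e * w₁ ^ 2 ∧ 4 * n₂ ^ 3 = u₂ ^ 2 + e * w₂ ^ 2 ∧
      a = (u₁ : ℤ) * w₂ - u₂ * w₁

namespace IsPairRep

variable {n₁ n₂ w₁ w₂ : ℕ} {a : ℤ}

theorem swap (h : IsPairRep n₁ n₂ w₁ w₂ a) : IsPairRep n₂ n₁ w₂ w₁ (-a) := by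
  obtain ⟨h1, h2, h3, h4, h5, u₁, u₂, e, h6, h7, h8⟩ := h
  exact ⟨h2, h1, h3.symm, h5, h4, u₂, u₁, e, h7, h6, by rw [h8]; ring⟩

theorem dvd (h : IsPairRep n₁ n₂ w₁ w₂ a) :
    a ∣ 4 * ((n₁ : ℤ) ^ 3 * w₂ ^ 2 - n₂ ^ 3 * w₁ ^ 2) := by
  obtain ⟨-, -, -, -, -, u₁, u₂, e, h6, h7, h8⟩ := h
  have h6' : (4 * n₁ ^ 3 : ℤ) = u₁ ^ 2 + e * w₁ ^ 2 := by exact_mod_cast h6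
  have h7' : (4 * n₂ ^ 3 : ℤ) = u₂ ^ 2 + e * w₂ ^ 2 := by exact_mod_cast h7
  refine ⟨(u₁ : ℤ) * w₂ + u₂ * w₁, ?_⟩
  rw [h8]
  linear_combination (w₂ : ℤ) ^ 2 * h6' - (w₁ : ℤ) ^ 2 * h7'

theorem sub_ne_zero (h : IsPairRep n₁ n₂ w₁ w₂ a) (hn : n₁ ≠ n₂) :
    4 * ((n₁ : ℤ) ^ 3 * w₂ ^ 2 - n₂ ^ 3 * w₁ ^ 2) ≠ 0 := by
  obtain ⟨-, -, h3, h4, h5, -⟩ := h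
  intro h0
  have h1 : n₁ ^ 3 * w₂ ^ 2 = n₂ ^ 3 * w₁ ^ 2 := by
    have : (n₁ : ℤ) ^ 3 * w₂ ^ 2 = n₂ ^ 3 * w₁ ^ 2 := by linarith
    exact_mod_cast this
  have h12 : n₁ ^ 3 ∣ n₂ ^ 3 :=
    (Nat.Coprime.pow 3 2 h4.symm).dvd_of_dvd_mul_right (h1 ▸ dvd_mul_right _ _)
  have h21 : n₂ ^ 3 ∣ n₁ ^ 3 :=
    (Nat.Coprime.pow 3 2 h5.symm).dvd_of_dvd_mul_right (h1.symm ▸ dvd_mul_right _ _)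
  rw [Nat.pow_dvd_pow_iff (by norm_num)] at h12 h21
  exact hn (Nat.dvd_antisymm h12 h21)

theorem ne_zero (h : IsPairRep n₁ n₂ w₁ w₂ a) (hn : n₁ ≠ n₂) : a ≠ 0 := fun h0 =>
  h.sub_ne_zero hn (zero_dvd_iff.mp (h0 ▸ h.dvd))

theorem isCoprime_left (h : IsPairRep n₁ n₂ w₁ w₂ a) (h₁ : Odd n₁) (hn : n₁.Coprime n₂) :
    IsCoprime (n₁ : ℤ) a := by
  obtain ⟨-, -, -, h4, -, -⟩ := id h
  have c2 : IsCoprime (n₁ : ℤ) 4 := by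
    have : Nat.Coprime n₁ (2 ^ 2) := (Nat.Coprime.pow_right 2 h₁.coprime_two_right)
    exact_mod_cast (Nat.isCoprime_iff_coprime.mpr this)
  have c3 : IsCoprime (n₁ : ℤ) n₂ := Nat.isCoprime_iff_coprime.mpr hn
  have c4 : IsCoprime (n₁ : ℤ) w₁ := Nat.isCoprime_iff_coprime.mpr h4.symm
  have c5 : IsCoprime (n₁ : ℤ) (-(4 * (n₂ ^ 3 * w₁ ^ 2))) :=
    (c2.mul_right (c3.pow_right.mul_right c4.pow_right)).neg_right
  have c6 := c5.add_mul_left_right (4 * n₁ ^ 2 * w₂ ^ 2)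
  refine c6.of_isCoprime_of_dvd_right (h.dvd.trans (dvd_of_eq (by ring)))

theorem isCoprime_right (h : IsPairRep n₁ n₂ w₁ w₂ a) (h₂ : Odd n₂) (hn : n₁.Coprime n₂) :
    IsCoprime (n₂ : ℤ) a :=
  (IsCoprime.neg_right_iff _ _).mp (h.swap.isCoprime_left h₂ hn.symm)

theorem exists_mul_add_mul_eq_two (h : IsPairRep n₁ n₂ w₁ w₂ a) :
    ∃ α β : ℤ, α * a + β * w₂ = 2 := by
  obtain ⟨-, -, h3, -, h5, u₁, u₂, e, -, h7, h8⟩ := h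
  set g := Int.gcd a w₂ with hg
  have hgw : g ∣ w₂ := by
    have : (g : ℤ) ∣ w₂ := Int.gcd_dvd_right _ _
    exact_mod_cast this
  have hgu : g ∣ u₂ := by
    have h9 : (g : ℤ) ∣ a := Int.gcd_dvd_left _ _
    have h10 : (g : ℤ) ∣ u₂ * w₁ := by
      have : (u₂ * w₁ : ℤ) = u₁ * w₂ - a := by rw [h8]; ring
      rw [this]
      exact dvd_sub ((Int.natCast_dvd_natCast.mpr hgw).mul_left _) h9
    have h11 : g ∣ u₂ * w₁ := by exact_mod_cast h10
    exact (Nat.Coprime.coprime_dvd_left hgw h3.symm).dvd_of_dvd_mul_right h11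
  have hg2 : g ^ 2 ∣ 4 * n₂ ^ 3 := by
    rw [h7]
    exact dvd_add (pow_dvd_pow_of_dvd hgu 2) ((pow_dvd_pow_of_dvd hgw 2).mul_left _)
  have hg4 : g ^ 2 ∣ 2 ^ 2 :=
    (Nat.Coprime.pow 2 3 (Nat.Coprime.coprime_dvd_left hgw h5)).dvd_of_dvd_mul_right hg2
  rw [Nat.pow_dvd_pow_iff (by norm_num)] at hg4
  obtain ⟨k, hk⟩ := hg4
  refine ⟨Int.gcdA a w₂ * k, Int.gcdB a w₂ * k, ?_⟩
  have h12 := Int.gcd_eq_gcd_ab a w₂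
  rw [← hg] at h12
  have hk' : (2 : ℤ) = g * k := by exact_mod_cast hk
  linear_combination -(k : ℤ) * h12 - hk'

theorem dvd_cube_sub {n₁' n₂' : ℕ} (h : IsPairRep n₁ n₂ w₁ w₂ a)
    (h' : IsPairRep n₁' n₂' w₁ w₂ a) : (w₁ : ℤ) ∣ 16 * ((n₁ : ℤ) ^ 3 - n₁' ^ 3) := by
  obtain ⟨-, -, h3, -, -, u₁, u₂, e, h6, -, h8⟩ := h
  obtain ⟨-, -, -, -, -, v₁, v₂, e', h6', -, h8'⟩ := h'
  have h6 : (4 * n₁ ^ 3 : ℤ) = u₁ ^ 2 + e * w₁ ^ 2 := by exact_mod_cast h6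
  have h6' : (4 * n₁' ^ 3 : ℤ) = v₁ ^ 2 + e' * w₁ ^ 2 := by exact_mod_cast h6'
  have h9 : (w₁ : ℤ) ∣ (u₁ - v₁) * w₂ := ⟨u₂ - v₂, by linear_combination h8' - h8⟩
  have h10 : (w₁ : ℤ) ∣ u₁ - v₁ := (Nat.isCoprime_iff_coprime.mpr h3).dvd_of_dvd_mul_right h9
  have h11 : (w₁ : ℤ) ∣ (u₁ - v₁) * (4 * (u₁ + v₁)) + w₁ * (4 * w₁ * (e - e')) :=
    dvd_add (h10.mul_right _) (dvd_mul_right _ _)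
  exact h11.trans (dvd_of_eq (by linear_combination 4 * h6' - 4 * h6))

theorem exists_ratio (h : IsPairRep n₁ n₂ w₁ w₂ a) (h₁ : Odd n₁) (h₂ : Odd n₂)
    (hn : n₁.Coprime n₂) :
    ∃ r : ℤ, IsCoprime r a ∧ a ∣ n₁ - r * n₂ ∧ a ∣ 4 * ((w₂ : ℤ) ^ 2 * r ^ 3 - w₁ ^ 2) := by
  have c1 := h.isCoprime_left h₁ hn
  have c2 := h.isCoprime_right h₂ hn
  obtain ⟨α, β, hαβ⟩ := id c2
  have hr : a ∣ n₁ - n₁ * α * n₂ := ⟨n₁ * β, by linear_combination -(n₁ : ℤ) * hαβ⟩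
  refine ⟨n₁ * α, c1.mul_left ⟨n₂, β, by linear_combination hαβ⟩, hr, ?_⟩
  have h3 : a ∣ (n₂ : ℤ) ^ 3 * (4 * ((w₂ : ℤ) ^ 2 * (n₁ * α) ^ 3 - w₁ ^ 2)) := by
    have := dvd_sub h.dvd (hr.mul_right
      (4 * (w₂ : ℤ) ^ 2 * (n₁ ^ 2 + n₁ * (n₁ * α * n₂) + (n₁ * α * n₂) ^ 2)))
    exact this.trans (dvd_of_eq (by ring))
  exact (c2.symm.pow_right).dvd_of_dvd_mul_left h3

/-- For fixed `w₁, w₂, a`, the pairs `(n₁, n₂)` can be coloured by few colours in such a way that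
differences of pairs of the same colour satisfy strong divisibility conditions. -/
theorem exists_coloring (w₁ w₂ : ℕ) (a : ℤ) (hw₁ : w₁ ≠ 0) (hw₂ : w₂ ≠ 0) (ha : a ≠ 0)
    (F : Set (ℕ × ℕ)) (hF : ∀ n ∈ F, IsPairRep n.1 n.2 w₁ w₂ a ∧ Odd n.1 ∧ Odd n.2 ∧
      n.1.Coprime n.2) :
    ∃ f : ℕ × ℕ → (ℕ × ℕ) × (ℕ × ℕ) × (ℕ × ℕ),
      (∀ n, f n ∈ (w₁.divisors ×ˢ w₁.divisors) ×ˢ (w₂.divisors ×ˢ w₂.divisors) ×ˢ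
        (a.natAbs.divisors ×ˢ a.natAbs.divisors)) ∧
      ∀ n ∈ F, ∀ n' ∈ F, f n = f n' →
        (w₁ : ℤ) ∣ 2304 * ((n.1 : ℤ) - n'.1) ∧ (w₂ : ℤ) ∣ 2304 * ((n.2 : ℤ) - n'.2) ∧
        a ∣ 4 * 2304 ^ 3 * ((w₂ : ℤ) ^ 2 * ((n.1 : ℤ) - n'.1) ^ 3 -
          (w₁ : ℤ) ^ 2 * ((n.2 : ℤ) - n'.2) ^ 3) := by
  obtain ⟨f₁, hf₁, hf₁'⟩ := exists_coloring_of_cubes w₁ hw₁ ((fun n : ℕ × ℕ => (n.1 : ℤ)) '' F)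
    (by
      rintro _ ⟨n, hn, rfl⟩
      exact Nat.isCoprime_iff_coprime.mpr (hF n hn).1.2.2.2.1.symm)
    (by
      rintro _ ⟨n, hn, rfl⟩ _ ⟨n', hn', rfl⟩
      exact (hF n hn).1.dvd_cube_sub (hF n' hn').1)
  obtain ⟨f₂, hf₂, hf₂'⟩ := exists_coloring_of_cubes w₂ hw₂ ((fun n : ℕ × ℕ => (n.2 : ℤ)) '' F)
    (by
      rintro _ ⟨n, hn, rfl⟩
      exact Nat.isCoprime_iff_coprime.mpr (hF n hn).1.2.2.2.2.1.symm)
    (by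
      rintro _ ⟨n, hn, rfl⟩ _ ⟨n', hn', rfl⟩
      exact (hF n hn).1.swap.dvd_cube_sub (hF n' hn').1.swap)
  have hr : ∀ n : ℕ × ℕ, ∃ r : ℤ, n ∈ F → IsCoprime r a ∧ a ∣ n.1 - r * n.2 ∧
      a ∣ 4 * ((w₂ : ℤ) ^ 2 * r ^ 3 - w₁ ^ 2) := by
    intro n
    by_cases hn : n ∈ F
    · obtain ⟨h1, h2, h3, h4⟩ := hF n hn
      obtain ⟨r, hr⟩ := h1.exists_ratio h2 h3 h4
      exact ⟨r, fun _ => hr⟩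
    · exact ⟨0, fun h => absurd h hn⟩
  choose r hr using hr
  obtain ⟨f₃, hf₃, hf₃'⟩ := exists_coloring_of_cubes a.natAbs (Int.natAbs_ne_zero.mpr ha) (r '' F)
    (by
      rintro _ ⟨n, hn, rfl⟩
      rw [Int.natCast_natAbs, IsCoprime.abs_right_iff]
      exact (hr n hn).1)
    (by
      rintro _ ⟨n, hn, rfl⟩ _ ⟨n', hn', rfl⟩
      rw [Int.natAbs_dvd]
      obtain ⟨α, β, hαβ⟩ := (hF n hn).1.exists_mul_add_mul_eq_two
      have h1 : a ∣ 4 * (w₂ : ℤ) ^ 2 * (r n ^ 3 - r n' ^ 3) :=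
        (dvd_sub (hr n hn).2.2 (hr n' hn').2.2).trans (dvd_of_eq (by ring))
      have h2 := dvd_add (h1.mul_right (β ^ 2))
        (dvd_mul_right a ((α ^ 2 * a + 2 * α * β * w₂) * (4 * (r n ^ 3 - r n' ^ 3))))
      refine h2.trans (dvd_of_eq ?_)
      linear_combination (4 * (r n ^ 3 - r n' ^ 3)) * (α * a + β * w₂ + 2) * hαβ)
  refine ⟨fun n => (f₁ n.1, f₂ n.2, f₃ (r n)), fun n => ?_, fun n hn n' hn' hnn => ?_⟩
  · exact Finset.mem_product.mpr ⟨hf₁ _, Finset.mem_product.mpr ⟨hf₂ _, hf₃ _⟩⟩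
  simp only [Prod.mk.injEq] at hnn
  obtain ⟨e1, e2, e3⟩ := hnn
  refine ⟨hf₁' _ ⟨n, hn, rfl⟩ _ ⟨n', hn', rfl⟩ e1, hf₂' _ ⟨n, hn, rfl⟩ _ ⟨n', hn', rfl⟩ e2, ?_⟩
  have h3 := hf₃' _ ⟨n, hn, rfl⟩ _ ⟨n', hn', rfl⟩ e3
  rw [Int.natAbs_dvd] at h3
  obtain ⟨-, h4, h5⟩ := hr n hn
  obtain ⟨-, h4', -⟩ := hr n' hn'
  set x : ℤ := (n.1 : ℤ) - n'.1
  set y : ℤ := (n.2 : ℤ) - n'.2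
  have h6 : a ∣ 2304 * x - r n * (2304 * y) := by
    have := dvd_add ((dvd_sub h4 h4').mul_right 2304) (h3.mul_right (n'.2 : ℤ))
    refine this.trans (dvd_of_eq ?_)
    ring
  have h7 := dvd_add (h6.mul_right (4 * (w₂ : ℤ) ^ 2 *
    ((2304 * x) ^ 2 + (2304 * x) * (r n * (2304 * y)) + (r n * (2304 * y)) ^ 2)))
    (h5.mul_right ((2304 * y) ^ 3))
  exact h7.trans (dvd_of_eq (by ring))

end IsPairRep

/-- Two distinct points of a large finite set in a square are close to each other. -/
theorem exists_close_pair (F : Finset (ℕ × ℕ)) (M : ℕ)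
    (hF : ∀ n ∈ F, n.1 ∈ Finset.Icc 1 M ∧ n.2 ∈ Finset.Icc 1 M) (h2 : 1 < F.card) :
    ∃ n ∈ F, ∃ n' ∈ F, n ≠ n' ∧ (F.card : ℝ) ≤
      4 * (M : ℝ) ^ 2 * (1 / ((max (|(n.1 : ℤ) - n'.1|) 1 : ℤ) *
        (max (|(n.2 : ℤ) - n'.2|) 1 : ℤ) : ℝ)) := by
  classical
  simp only [Finset.mem_Icc] at hF
  obtain ⟨p, hp, hmin⟩ := Finset.exists_min_image F.offDiag
    (fun p : (ℕ × ℕ) × (ℕ × ℕ) =>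
      max (|(p.1.1 : ℤ) - p.2.1|) (|(p.1.2 : ℤ) - p.2.2|)) (by
    obtain ⟨a, ha, b, hb, hab⟩ := Finset.one_lt_card.mp h2
    exact ⟨(a, b), Finset.mem_offDiag.mpr ⟨ha, hb, hab⟩⟩)
  obtain ⟨hn, hn', hne⟩ := Finset.mem_offDiag.mp hp
  obtain ⟨n, n'⟩ := p
  simp only at hn hn' hne
  refine ⟨n, hn, n', hn', hne, ?_⟩
  set δ : ℤ := max (|(n.1 : ℤ) - n'.1|) (|(n.2 : ℤ) - n'.2|) with hδ
  have hδ1 : 1 ≤ δ := by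
    by_contra! hlt
    have h1 : |(n.1 : ℤ) - n'.1| ≤ 0 := by have := le_max_left (|(n.1 : ℤ) - n'.1|) (|(n.2 : ℤ) - n'.2|); omega
    have h2 : |(n.2 : ℤ) - n'.2| ≤ 0 := by have := le_max_right (|(n.1 : ℤ) - n'.1|) (|(n.2 : ℤ) - n'.2|); omega
    rw [abs_nonpos_iff] at h1 h2
    exact hne (Prod.ext (by omega) (by omega))
  have hδM : δ ≤ M := by
    have := hF n hn
    have := hF n' hn'
    refine max_le (abs_le.mpr ?_) (abs_le.mpr ?_) <;> constructor <;> omega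
  obtain ⟨k, hk⟩ := Int.eq_ofNat_of_zero_le (by omega : 0 ≤ δ)
  have hk1 : 1 ≤ k := by omega
  have hkM : k ≤ M := by omega
  have hcard : F.card ≤ (M / k + 1) * (M / k + 1) := by
    have : F.card ≤ (Finset.range (M / k + 1) ×ˢ Finset.range (M / k + 1)).card := by
      refine Finset.card_le_card_of_injOn (fun m => (m.1 / k, m.2 / k)) (fun m hm => ?_) ?_
      · have := hF m hm
        simp only [Finset.coe_product, Set.mem_prod, Finset.mem_coe, Finset.mem_range]
        exact ⟨Nat.lt_succ_of_le (Nat.div_le_div_right this.1.2),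
          Nat.lt_succ_of_le (Nat.div_le_div_right this.2.2)⟩
      · intro m hm m' hm' hmm
        by_contra hne'
        have h3 := hmin (m, m') (Finset.mem_offDiag.mpr ⟨hm, hm', hne'⟩)
        simp only [Prod.mk.injEq] at hmm h3
        have key : ∀ s t : ℕ, s / k = t / k → |(s : ℤ) - t| < k := by
          intro s t hst
          have h4 := Nat.div_add_mod s k
          have h5 := Nat.div_add_mod t k
          have h6 := Nat.mod_lt s (by omega : k > 0)
          have h7 := Nat.mod_lt t (by omega : k > 0)
          rw [hst] at h4
          rw [abs_lt]; constructor <;> omega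
        have h4 := max_lt (key _ _ hmm.1) (key _ _ hmm.2)
        have h5 : δ = k := by simpa using hk
        rw [hδ] at h5
        omega
    simpa using this
  have hcard' : (F.card : ℝ) ≤ 4 * (M : ℝ) ^ 2 * (1 / ((k : ℝ) * k)) := by
    have hk0 : (0 : ℝ) < k := by exact_mod_cast hk1
    have h3 : ((M / k : ℕ) : ℝ) + 1 ≤ 2 * M / k := by
      have h4 : ((M / k : ℕ) : ℝ) ≤ M / k := Nat.cast_div_le
      have h5 : (1 : ℝ) ≤ M / k := by rw [one_le_div hk0]; exact_mod_cast hkM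
      calc _ ≤ (M : ℝ) / k + M / k := add_le_add h4 h5
        _ = _ := by ring
    calc (F.card : ℝ) ≤ (((M / k : ℕ) : ℝ) + 1) * (((M / k : ℕ) : ℝ) + 1) := by exact_mod_cast hcard
      _ ≤ (2 * M / k) * (2 * M / k) := by gcongr
      _ = _ := by field_simp; ring
  refine hcard'.trans ?_
  have hm1 : max (|(n.1 : ℤ) - n'.1|) 1 ≤ δ := max_le (le_max_left _ _) hδ1
  have hm2 : max (|(n.2 : ℤ) - n'.2|) 1 ≤ δ := max_le (le_max_right _ _) hδ1
  have hp1 : 0 < max (|(n.1 : ℤ) - n'.1|) 1 := lt_max_of_lt_right one_pos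
  have hp2 : 0 < max (|(n.2 : ℤ) - n'.2|) 1 := lt_max_of_lt_right one_pos
  have hδk : δ = (k : ℤ) := by simpa using hk
  rw [hδk] at hm1 hm2
  have hm1' : ((max (|(n.1 : ℤ) - n'.1|) 1 : ℤ) : ℝ) ≤ k := by exact_mod_cast hm1
  have hm2' : ((max (|(n.2 : ℤ) - n'.2|) 1 : ℤ) : ℝ) ≤ k := by exact_mod_cast hm2
  have hp1' : (0 : ℝ) < ((max (|(n.1 : ℤ) - n'.1|) 1 : ℤ) : ℝ) := by exact_mod_cast hp1
  have hp2' : (0 : ℝ) < ((max (|(n.2 : ℤ) - n'.2|) 1 : ℤ) : ℝ) := by exact_mod_cast hp2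
  gcongr

/-- The weight `1 / (max(|x|, 1) max(|y|, 1))` is a product; this is one factor. -/
noncomputable def recipWeight (x : ℤ) : ℝ := 1 / ((max |x| 1 : ℤ) : ℝ)

theorem recipWeight_nonneg (x : ℤ) : 0 ≤ recipWeight x := by
  have : (0 : ℤ) ≤ max |x| 1 := (zero_le_one).trans (le_max_right _ _)
  have : (0 : ℝ) ≤ ((max |x| 1 : ℤ) : ℝ) := by exact_mod_cast this
  unfold recipWeight; positivity

theorem card_le_of_coloring {γ : Type*} [DecidableEq γ] (F : Finset (ℕ × ℕ)) (M : ℕ)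
    (hF : ∀ n ∈ F, n.1 ∈ Finset.Icc 1 M ∧ n.2 ∈ Finset.Icc 1 M) (f : ℕ × ℕ → γ) (K : Finset γ)
    (hf : ∀ n, f n ∈ K) (G : Finset (ℤ × ℤ))
    (hG : ∀ n ∈ F, ∀ n' ∈ F, n ≠ n' → f n = f n' →
      ((n.1 : ℤ) - n'.1, (n.2 : ℤ) - n'.2) ∈ G) :
    (F.card : ℝ) ≤ K.card *
      (1 + 4 * (M : ℝ) ^ 2 * ∑ z ∈ G, recipWeight z.1 * recipWeight z.2) := by
  have hnn : ∀ z ∈ G, 0 ≤ recipWeight z.1 * recipWeight z.2 := fun z _ =>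
    mul_nonneg (recipWeight_nonneg _) (recipWeight_nonneg _)
  rw [Finset.card_eq_sum_card_fiberwise (f := f) (t := K) (fun n _ => hf n)]
  push_cast
  rw [← nsmul_eq_mul]
  refine Finset.sum_le_card_nsmul _ _ _ fun κ _ => ?_
  have hsum : 0 ≤ 4 * (M : ℝ) ^ 2 * ∑ z ∈ G, recipWeight z.1 * recipWeight z.2 :=
    mul_nonneg (by positivity) (Finset.sum_nonneg hnn)
  rcases le_or_gt (F.filter (fun n => f n = κ)).card 1 with h1 | h1
  · have : ((F.filter (fun n => f n = κ)).card : ℝ) ≤ 1 := by exact_mod_cast h1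
    linarith
  obtain ⟨n, hn, n', hn', hne, hle⟩ := exists_close_pair _ M
    (fun n hn => hF n (Finset.mem_filter.mp hn).1) h1
  rw [Finset.mem_filter] at hn hn'
  have hmem := hG n hn.1 n' hn'.1 hne (hn.2.trans hn'.2.symm)
  have h3 := Finset.single_le_sum hnn hmem
  have h4 : (4 * (M : ℝ) ^ 2) * (recipWeight ((n.1 : ℤ) - n'.1) * recipWeight ((n.2 : ℤ) - n'.2)) ≤
      4 * (M : ℝ) ^ 2 * ∑ z ∈ G, recipWeight z.1 * recipWeight z.2 :=
    mul_le_mul_of_nonneg_left h3 (by positivity)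
  have h5 : recipWeight ((n.1 : ℤ) - n'.1) * recipWeight ((n.2 : ℤ) - n'.2) =
      1 / ((max (|(n.1 : ℤ) - n'.1|) 1 : ℤ) * (max (|(n.2 : ℤ) - n'.2|) 1 : ℤ) : ℝ) := by
    unfold recipWeight; rw [one_div_mul_one_div]
  rw [h5] at h4
  linarith

theorem card_int_divisors_le (S : Finset ℤ) (N : ℤ) (hN : N ≠ 0) (hS : ∀ a ∈ S, a ∣ N) :
    S.card ≤ 2 * N.natAbs.divisors.card := by
  classical
  have hsub : S ⊆ N.natAbs.divisors.image (fun k : ℕ => (k : ℤ)) ∪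
      N.natAbs.divisors.image (fun k : ℕ => -(k : ℤ)) := by
    intro a ha
    have h1 : a.natAbs ∈ N.natAbs.divisors :=
      Nat.mem_divisors.mpr ⟨Int.natAbs_dvd_natAbs.mpr (hS a ha), Int.natAbs_ne_zero.mpr hN⟩
    rw [Finset.mem_union, Finset.mem_image, Finset.mem_image]
    rcases Int.natAbs_eq a with h | h
    · exact Or.inl ⟨_, h1, h.symm⟩
    · exact Or.inr ⟨_, h1, h.symm⟩
  calc S.card ≤ _ := Finset.card_le_card hsub
    _ ≤ _ := Finset.card_union_le _ _
    _ ≤ N.natAbs.divisors.card + N.natAbs.divisors.card :=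
        add_le_add Finset.card_image_le Finset.card_image_le
    _ = _ := by ring

/-- If `w₂² x³ = w₁² y³` has a nonzero solution, then `w₁ w₂²` is a cube. -/
theorem exists_cube_eq_of_eq {w₁ w₂ : ℕ} (hw₁ : w₁ ≠ 0) (hw₂ : w₂ ≠ 0) {x y : ℤ}
    (hxy : (x, y) ≠ (0, 0)) (h : (w₂ : ℤ) ^ 2 * x ^ 3 = (w₁ : ℤ) ^ 2 * y ^ 3) :
    ∃ c : ℕ, c ^ 3 = w₁ * w₂ ^ 2 := by
  have h1 : (w₁ : ℤ) ≠ 0 := by exact_mod_cast hw₁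
  have h2 : (w₂ : ℤ) ≠ 0 := by exact_mod_cast hw₂
  have hx : x ≠ 0 := by
    rintro rfl
    have : y = 0 := by
      have h3 : (w₁ : ℤ) ^ 2 * y ^ 3 = 0 := by rw [← h]; ring
      simpa [hw₁] using h3
    exact hxy (by rw [this])
  have h3 : x ^ 3 ∣ (w₁ * y) ^ 3 := ⟨w₁ * w₂ ^ 2, by linear_combination -(w₁ : ℤ) * h⟩
  obtain ⟨c, hc⟩ := (Int.pow_dvd_pow_iff (by norm_num)).mp h3
  have h4 : c ^ 3 = w₁ * w₂ ^ 2 := by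
    have : x ^ 3 * c ^ 3 = x ^ 3 * (w₁ * w₂ ^ 2) := by
      rw [← mul_pow, ← hc]; linear_combination -(w₁ : ℤ) * h
    exact mul_left_cancel₀ (pow_ne_zero 3 hx) this
  refine ⟨c.natAbs, ?_⟩
  have := congrArg Int.natAbs h4
  simpa [Int.natAbs_pow, Int.natAbs_mul] using this

/-- The sum of reciprocals over nonzero multiples, averaged over the modulus. -/
theorem sum_sum_recipWeight_le (M W T : ℕ)
    (hT : ∀ m : ℕ, m ≠ 0 → m ≤ 2304 * M → m.divisors.card ≤ T)
    (hH : ∑ x ∈ Finset.Icc 1 M, (1 / (x : ℝ)) ≤ T) :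
    ∑ w ∈ Finset.Icc 1 W, ∑ x ∈ (Finset.Icc (-(M : ℤ)) M).filter
      (fun x => x ≠ 0 ∧ (w : ℤ) ∣ 2304 * x), recipWeight x ≤ 2 * (T : ℝ) ^ 2 := by
  classical
  have hstep : ∀ w ∈ Finset.Icc 1 W, ∑ x ∈ (Finset.Icc (-(M : ℤ)) M).filter
      (fun x => x ≠ 0 ∧ (w : ℤ) ∣ 2304 * x), recipWeight x ≤
      ∑ x ∈ Finset.Icc 1 M, (if w ∣ 2304 * x then 2 * (1 / (x : ℝ)) else 0) := by
    intro w _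
    rw [← Finset.sum_filter]
    have hmaps : ∀ x ∈ (Finset.Icc (-(M : ℤ)) M).filter (fun x => x ≠ 0 ∧ (w : ℤ) ∣ 2304 * x),
        x.natAbs ∈ (Finset.Icc 1 M).filter (fun x => w ∣ 2304 * x) := by
      intro x hx
      simp only [Finset.mem_filter, Finset.mem_Icc] at hx ⊢
      refine ⟨by omega, ?_⟩
      have := Int.natAbs_dvd_natAbs.mpr hx.2.2
      simpa [Int.natAbs_mul] using this
    rw [← Finset.sum_fiberwise_of_maps_to hmaps]
    refine Finset.sum_le_sum fun k hk => ?_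
    simp only [Finset.mem_filter, Finset.mem_Icc] at hk
    have hle : ∀ x ∈ ((Finset.Icc (-(M : ℤ)) M).filter
        (fun x => x ≠ 0 ∧ (w : ℤ) ∣ 2304 * x)).filter (fun x => x.natAbs = k),
        recipWeight x ≤ 1 / (k : ℝ) := by
      intro x hx
      have hxk := (Finset.mem_filter.mp hx).2
      have : max |x| 1 = (k : ℤ) := by
        rw [Int.abs_eq_natAbs, hxk]; exact max_eq_left (by omega)
      unfold recipWeight; rw [this]; simp
    refine (Finset.sum_le_card_nsmul _ _ _ hle).trans ?_
    rw [nsmul_eq_mul]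
    refine mul_le_mul_of_nonneg_right ?_ (by positivity)
    have : (((Finset.Icc (-(M : ℤ)) M).filter
        (fun x => x ≠ 0 ∧ (w : ℤ) ∣ 2304 * x)).filter (fun x => x.natAbs = k)).card ≤
        ({(k : ℤ), -(k : ℤ)} : Finset ℤ).card := by
      refine Finset.card_le_card fun x hx => ?_
      have hxk := (Finset.mem_filter.mp hx).2
      simp only [Finset.mem_insert, Finset.mem_singleton]
      omega
    exact_mod_cast this.trans Finset.card_le_two
  refine (Finset.sum_le_sum hstep).trans ?_
  rw [Finset.sum_comm]
  have hin : ∀ x ∈ Finset.Icc 1 M,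
      ∑ w ∈ Finset.Icc 1 W, (if w ∣ 2304 * x then 2 * (1 / (x : ℝ)) else 0) ≤
        2 * T * (1 / (x : ℝ)) := by
    intro x hx
    rw [Finset.mem_Icc] at hx
    rw [← Finset.sum_filter, Finset.sum_const, nsmul_eq_mul]
    have h1 : ((Finset.Icc 1 W).filter (fun w => w ∣ 2304 * x)).card ≤ T := by
      refine (Finset.card_le_card fun w hw => ?_).trans (hT (2304 * x) (by omega) (by omega))
      exact Nat.mem_divisors.mpr ⟨(Finset.mem_filter.mp hw).2, by omega⟩
    have h2 : (((Finset.Icc 1 W).filter (fun w => w ∣ 2304 * x)).card : ℝ) ≤ T := by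
      exact_mod_cast h1
    calc _ ≤ (T : ℝ) * (2 * (1 / (x : ℝ))) := mul_le_mul_of_nonneg_right h2 (by positivity)
      _ = _ := by ring
  refine (Finset.sum_le_sum hin).trans ?_
  rw [← Finset.mul_sum]
  calc 2 * (T : ℝ) * ∑ x ∈ Finset.Icc 1 M, (1 / (x : ℝ)) ≤ 2 * T * T := by gcongr
    _ = _ := by ring

/-- Pairs of moduli with `w₁ w₂²` a cube are rare. -/
theorem card_filter_cube_le (W T : ℕ)
    (hT : ∀ m : ℕ, m ≠ 0 → m ≤ W ^ 3 → m.divisors.card ≤ T) :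
    ((Finset.Icc 1 W ×ˢ Finset.Icc 1 W).filter
      (fun w => ∃ c : ℕ, c ^ 3 = w.1 * w.2 ^ 2)).card ≤ W * T ^ 2 := by
  classical
  have hsub : (Finset.Icc 1 W ×ˢ Finset.Icc 1 W).filter
      (fun w => ∃ c : ℕ, c ^ 3 = w.1 * w.2 ^ 2) ⊆
      (Finset.Icc 1 W).biUnion (fun c => (c ^ 3).divisors ×ˢ (c ^ 3).divisors) := by
    intro w hw
    simp only [Finset.mem_filter, Finset.mem_product, Finset.mem_Icc] at hw
    obtain ⟨⟨⟨h1, h2⟩, h3, h4⟩, c, hc⟩ := hw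
    have hpos : 0 < c ^ 3 := by rw [hc]; positivity
    have hc0 : c ≠ 0 := by rintro rfl; simp at hpos
    have hcW : c ≤ W := by
      have : c ^ 3 ≤ W ^ 3 := by
        rw [hc]
        calc w.1 * w.2 ^ 2 ≤ W * W ^ 2 := Nat.mul_le_mul h2 (Nat.pow_le_pow_left h4 2)
          _ = W ^ 3 := by ring
      exact (Nat.pow_le_pow_iff_left (by norm_num)).mp this
    simp only [Finset.mem_biUnion, Finset.mem_Icc, Finset.mem_product, Nat.mem_divisors]
    refine ⟨c, ⟨by omega, hcW⟩, ⟨⟨w.2 ^ 2, hc⟩, hpos.ne'⟩, ⟨w.1 * w.2, by rw [hc]; ring⟩, hpos.ne'⟩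
  refine (Finset.card_le_card hsub).trans ?_
  refine (Finset.card_biUnion_le_card_mul _ _ (T ^ 2) fun c hc => ?_).trans (by simp)
  rw [Finset.mem_Icc] at hc
  have := hT (c ^ 3) (pow_ne_zero 3 (by omega)) (Nat.pow_le_pow_left hc.2 3)
  rw [Finset.card_product, sq]
  exact Nat.mul_le_mul this this

/-- The `a` in a representation are divisors of a bounded nonzero integer. -/
theorem card_isPairRep_le_mul_card (M W T : ℕ)
    (hT : ∀ m : ℕ, m ≠ 0 → m ≤ 8 * M ^ 3 * W ^ 2 → m.divisors.card ≤ T)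
    (K : Finset ((ℕ × ℕ) × (ℕ × ℕ) × ℤ))
    (hK : ∀ k ∈ K, IsPairRep k.1.1 k.1.2 k.2.1.1 k.2.1.2 k.2.2 ∧ k.1.1 ≠ k.1.2 ∧
      k.1.1 ≤ M ∧ k.1.2 ≤ M ∧ k.2.1.1 ≤ W ∧ k.2.1.2 ≤ W) :
    K.card ≤ 2 * T * (K.image (fun k => (k.1, k.2.1))).card := by
  classical
  refine Finset.card_le_mul_card_image K (2 * T) fun b hb => ?_
  obtain ⟨k₀, hk₀, rfl⟩ := Finset.mem_image.mp hb
  obtain ⟨h1, h2, h3, h4, h5, h6⟩ := hK k₀ hk₀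
  set N : ℤ := 4 * ((k₀.1.1 : ℤ) ^ 3 * k₀.2.1.2 ^ 2 - k₀.1.2 ^ 3 * k₀.2.1.1 ^ 2) with hN
  have hN0 : N ≠ 0 := h1.sub_ne_zero h2
  have hNle : N.natAbs ≤ 8 * M ^ 3 * W ^ 2 := by
    have e1 : (k₀.1.1 : ℤ) ^ 3 * k₀.2.1.2 ^ 2 ≤ M ^ 3 * W ^ 2 := by
      exact_mod_cast Nat.mul_le_mul (Nat.pow_le_pow_left h3 3) (Nat.pow_le_pow_left h6 2)
    have e2 : (k₀.1.2 : ℤ) ^ 3 * k₀.2.1.1 ^ 2 ≤ M ^ 3 * W ^ 2 := by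
      exact_mod_cast Nat.mul_le_mul (Nat.pow_le_pow_left h4 3) (Nat.pow_le_pow_left h5 2)
    have e3 : 0 ≤ (k₀.1.1 : ℤ) ^ 3 * k₀.2.1.2 ^ 2 := by positivity
    have e4 : 0 ≤ (k₀.1.2 : ℤ) ^ 3 * k₀.2.1.1 ^ 2 := by positivity
    have e5 : |N| ≤ 8 * M ^ 3 * W ^ 2 := by
      rw [hN, abs_le]; constructor <;> linarith
    rw [Int.abs_eq_natAbs] at e5
    exact_mod_cast e5
  have hcard := card_int_divisors_le
    ((K.filter (fun k => (k.1, k.2.1) = (k₀.1, k₀.2.1))).image (fun k => k.2.2)) N hN0 (by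
      intro a ha
      obtain ⟨k, hk, rfl⟩ := Finset.mem_image.mp ha
      obtain ⟨hk, he⟩ := Finset.mem_filter.mp hk
      have h7 := (hK k hk).1.dvd
      simp only [Prod.mk.injEq] at he
      rwa [he.1, he.2] at h7)
  rw [Finset.card_image_of_injOn] at hcard
  · exact hcard.trans (Nat.mul_le_mul_left 2 (hT _ (Int.natAbs_ne_zero.mpr hN0) hNle))
  · intro k hk k' hk' hkk
    have e1 := (Finset.mem_filter.mp hk).2
    have e2 := (Finset.mem_filter.mp hk').2
    simp only [Prod.mk.injEq] at e1 e2
    exact Prod.ext (e1.1.trans e2.1.symm) (Prod.ext (e1.2.trans e2.2.symm) hkk)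

/-- The nonzero differences of pairs compatible with the moduli `w₁, w₂`. -/
noncomputable def differenceSet (M : ℕ) (w : ℕ × ℕ) : Finset (ℤ × ℤ) :=
  (Finset.Icc (-(M : ℤ)) M ×ˢ Finset.Icc (-(M : ℤ)) M).filter
    (fun z => z ≠ (0, 0) ∧ (w.1 : ℤ) ∣ 2304 * z.1 ∧ (w.2 : ℤ) ∣ 2304 * z.2)

theorem sum_differenceSet_le (M : ℕ) (w : ℕ × ℕ) :
    ∑ z ∈ differenceSet M w, recipWeight z.1 * recipWeight z.2 ≤
      (∑ x ∈ (Finset.Icc (-(M : ℤ)) M).filter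
        (fun x => x ≠ 0 ∧ (w.1 : ℤ) ∣ 2304 * x), recipWeight x) +
      (∑ x ∈ (Finset.Icc (-(M : ℤ)) M).filter
        (fun x => x ≠ 0 ∧ (w.2 : ℤ) ∣ 2304 * x), recipWeight x) +
      (∑ x ∈ (Finset.Icc (-(M : ℤ)) M).filter
        (fun x => x ≠ 0 ∧ (w.1 : ℤ) ∣ 2304 * x), recipWeight x) *
      (∑ x ∈ (Finset.Icc (-(M : ℤ)) M).filter
        (fun x => x ≠ 0 ∧ (w.2 : ℤ) ∣ 2304 * x), recipWeight x) := by
  classical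
  set A : ℕ → Finset ℤ := fun w => (Finset.Icc (-(M : ℤ)) M).filter
        (fun x => x ≠ 0 ∧ (w : ℤ) ∣ 2304 * x) with hA
  have hsub : differenceSet M w ⊆
      ((A w.1 ×ˢ ({0} : Finset ℤ)) ∪ (({0} : Finset ℤ) ×ˢ A w.2)) ∪ (A w.1 ×ˢ A w.2) := by
    rintro ⟨x, y⟩ hz
    simp only [differenceSet, hA, Finset.mem_filter, Finset.mem_product, Finset.mem_union,
      Finset.mem_singleton, ne_eq, Prod.mk.injEq] at hz ⊢
    tauto
  have hnn : ∀ z : ℤ × ℤ, 0 ≤ recipWeight z.1 * recipWeight z.2 := fun z =>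
    mul_nonneg (recipWeight_nonneg _) (recipWeight_nonneg _)
  have h0 : recipWeight 0 = 1 := by simp [recipWeight]
  have hunion : ∀ s t : Finset (ℤ × ℤ), ∑ z ∈ s ∪ t, recipWeight z.1 * recipWeight z.2 ≤
      ∑ z ∈ s, recipWeight z.1 * recipWeight z.2 + ∑ z ∈ t, recipWeight z.1 * recipWeight z.2 := by
    intro s t
    rw [← Finset.sum_union_inter]
    exact le_add_of_nonneg_right (Finset.sum_nonneg fun z _ => hnn z)
  refine (Finset.sum_le_sum_of_subset_of_nonneg hsub fun z _ _ => hnn z).trans ?_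
  refine (hunion _ _).trans (add_le_add ((hunion _ _).trans (add_le_add ?_ ?_)) ?_)
  · rw [Finset.sum_product]; simp [h0, hA]
  · rw [Finset.sum_product]; simp [h0, hA]
  · rw [Finset.sum_product, Finset.sum_mul_sum]

/-- The main counting bound for coprime pairs `n₁, n₂`. -/
theorem card_isPairRep_le (M W A T : ℕ) (hW : 1 ≤ W) (hA : 1 ≤ A) (hT1 : 1 ≤ T) (hM : 1 ≤ M)
    (hT : ∀ m : ℕ, m ≠ 0 → m ≤ 8 * 2304 ^ 3 * M ^ 3 * W ^ 3 * A → m.divisors.card ≤ T)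
    (hH : ∑ x ∈ Finset.Icc 1 M, (1 / (x : ℝ)) ≤ T)
    (K : Finset ((ℕ × ℕ) × (ℕ × ℕ) × ℤ))
    (hK : ∀ k ∈ K, IsPairRep k.1.1 k.1.2 k.2.1.1 k.2.1.2 k.2.2 ∧ k.1.1 ≠ k.1.2 ∧
      k.1.1 ∈ Finset.Icc 1 M ∧ k.1.2 ∈ Finset.Icc 1 M ∧ k.2.1.1 ≤ W ∧ k.2.1.2 ≤ W ∧
      k.2.2 ∈ Finset.Icc (-(A : ℤ)) A ∧ Odd k.1.1 ∧ Odd k.1.2 ∧ k.1.1.Coprime k.1.2) :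
    (K.card : ℝ) ≤ 66 * (T : ℝ) ^ 11 * ((W : ℝ) ^ 2 * A + (M : ℝ) ^ 2 * W) := by
  classical
  have hM3 : 1 ≤ M ^ 3 := Nat.one_le_pow _ _ hM
  have hW3 : 1 ≤ W ^ 3 := Nat.one_le_pow _ _ hW
  have hbig : ∀ B : ℕ, B ≤ 8 * 2304 ^ 3 * M ^ 3 * W ^ 3 * A →
      ∀ m : ℕ, m ≠ 0 → m ≤ B → m.divisors.card ≤ T := fun B hB m hm hmB => hT m hm (hmB.trans hB)
  have hTW3 := hbig (W ^ 3) (by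
    calc W ^ 3 = 1 * 1 * W ^ 3 * 1 := by ring
      _ ≤ 8 * 2304 ^ 3 * M ^ 3 * W ^ 3 * A := by gcongr; norm_num)
  have hTW := hbig W (by
    calc W = 1 * 1 * W ^ 1 * 1 := by ring
      _ ≤ 8 * 2304 ^ 3 * M ^ 3 * W ^ 3 * A := by gcongr <;> norm_num)
  have hTA := hbig A (by
    calc A = 1 * 1 * 1 * A := by ring
      _ ≤ 8 * 2304 ^ 3 * M ^ 3 * W ^ 3 * A := by gcongr; norm_num)
  have hTM := hbig (2304 * M) (by
    calc 2304 * M = 2304 * M ^ 1 * 1 * 1 := by ring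
      _ ≤ 8 * 2304 ^ 3 * M ^ 3 * W ^ 3 * A := by gcongr <;> norm_num)
  have hTD := hbig (8 * M ^ 3 * W ^ 2) (by
    calc 8 * M ^ 3 * W ^ 2 = 8 * M ^ 3 * W ^ 2 * 1 := by ring
      _ ≤ 8 * 2304 ^ 3 * M ^ 3 * W ^ 3 * A := by gcongr <;> norm_num)
  have hTE := hbig (8 * 2304 ^ 3 * M ^ 3 * W ^ 2) (by
    calc 8 * 2304 ^ 3 * M ^ 3 * W ^ 2 = 8 * 2304 ^ 3 * M ^ 3 * W ^ 2 * 1 := by ring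
      _ ≤ 8 * 2304 ^ 3 * M ^ 3 * W ^ 3 * A := by gcongr; norm_num)
  set deg : ℕ × ℕ → Prop := fun w => ∃ c : ℕ, c ^ 3 = w.1 * w.2 ^ 2 with hdeg
  set WW := Finset.Icc 1 W ×ˢ Finset.Icc 1 W with hWW
  set MM := Finset.Icc 1 M ×ˢ Finset.Icc 1 M with hMM
  set AA := (Finset.Icc (-(A : ℤ)) A).erase 0 with hAA
  have hmemWW : ∀ k ∈ K, k.2.1 ∈ WW := by
    intro k hk
    obtain ⟨h1, -, -, -, h5, h6, -⟩ := hK k hk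
    exact Finset.mem_product.mpr ⟨Finset.mem_Icc.mpr ⟨h1.1, h5⟩, Finset.mem_Icc.mpr ⟨h1.2.1, h6⟩⟩
  have hmemAA : ∀ k ∈ K, k.2.2 ∈ AA := by
    intro k hk
    obtain ⟨h1, h2, -, -, -, -, h7, -⟩ := hK k hk
    exact Finset.mem_erase.mpr ⟨h1.ne_zero h2, h7⟩
  -- degenerate moduli
  have hdegle : ((K.filter (fun k => deg k.2.1)).card : ℝ) ≤ 2 * T ^ 3 * ((M : ℝ) ^ 2 * W) := by
    have h1 : (K.filter (fun k => deg k.2.1)).card ≤ 2 * T * (M * M * (W * T ^ 2)) := by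
      refine (card_isPairRep_le_mul_card M W T hTD _ fun k hk => ?_).trans
        (Nat.mul_le_mul_left _ ?_)
      · obtain ⟨h1, h2, h3, h4, h5, h6, -⟩ := hK k (Finset.mem_filter.mp hk).1
        exact ⟨h1, h2, (Finset.mem_Icc.mp h3).2, (Finset.mem_Icc.mp h4).2, h5, h6⟩
      · calc _ ≤ (MM ×ˢ (WW.filter deg)).card := by
              refine Finset.card_le_card fun b hb => ?_
              obtain ⟨k, hk, rfl⟩ := Finset.mem_image.mp hb
              obtain ⟨hk, hkd⟩ := Finset.mem_filter.mp hk
              obtain ⟨h1, h2, h3, h4, -⟩ := hK k hk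
              exact Finset.mem_product.mpr ⟨Finset.mem_product.mpr ⟨h3, h4⟩,
                Finset.mem_filter.mpr ⟨hmemWW k hk, hkd⟩⟩
          _ ≤ _ := by
              rw [Finset.card_product, hMM, Finset.card_product, Nat.card_Icc,
                Nat.add_sub_cancel]
              exact Nat.mul_le_mul_left _ (card_filter_cube_le W T hTW3)
    calc ((K.filter (fun k => deg k.2.1)).card : ℝ) ≤ ((2 * T * (M * M * (W * T ^ 2)) : ℕ) : ℝ) := by
          exact_mod_cast h1
      _ = _ := by push_cast; ring
  -- nondegenerate moduli
  set WN := WW.filter (fun w => ¬ deg w) with hWN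
  set E : ℕ × ℕ → ℤ × ℤ → ℤ := fun w z =>
    4 * 2304 ^ 3 * ((w.2 : ℤ) ^ 2 * z.1 ^ 3 - (w.1 : ℤ) ^ 2 * z.2 ^ 3) with hE
  have hnn : ∀ z : ℤ × ℤ, 0 ≤ recipWeight z.1 * recipWeight z.2 := fun z =>
    mul_nonneg (recipWeight_nonneg _) (recipWeight_nonneg _)
  have hfib : ∀ t ∈ WN ×ˢ AA,
      (((K.filter (fun k => ¬ deg k.2.1)).filter (fun k => k.2 = t)).card : ℝ) ≤
      (T : ℝ) ^ 6 * (1 + 4 * (M : ℝ) ^ 2 * ∑ z ∈ (differenceSet M t.1).filter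
        (fun z => t.2 ∣ E t.1 z), recipWeight z.1 * recipWeight z.2) := by
    rintro ⟨w, a⟩ ht
    obtain ⟨hw, ha⟩ := Finset.mem_product.mp ht
    simp only at hw ha ⊢
    have hw' := (Finset.mem_filter.mp hw).1
    rw [hWW, Finset.mem_product, Finset.mem_Icc, Finset.mem_Icc] at hw'
    obtain ⟨ha0, haA⟩ := Finset.mem_erase.mp ha
    rw [Finset.mem_Icc] at haA
    set F := ((K.filter (fun k => ¬ deg k.2.1)).filter (fun k => k.2 = (w, a))).image
      (fun k => k.1) with hF
    have hFmem : ∀ n ∈ F, (n, (w, a)) ∈ K := by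
      intro n hn
      obtain ⟨k, hk, rfl⟩ := Finset.mem_image.mp hn
      obtain ⟨hk, he⟩ := Finset.mem_filter.mp hk
      rw [← he]; exact (Finset.mem_filter.mp hk).1
    have hcardF : F.card =
        ((K.filter (fun k => ¬ deg k.2.1)).filter (fun k => k.2 = (w, a))).card := by
      refine Finset.card_image_of_injOn fun k hk k' hk' hkk => ?_
      exact Prod.ext hkk ((Finset.mem_filter.mp hk).2.trans (Finset.mem_filter.mp hk').2.symm)
    rw [← hcardF]
    obtain ⟨f, hf, hff⟩ := IsPairRep.exists_coloring w.1 w.2 a (by omega) (by omega) ha0 (F : Set _)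
      (fun n hn => by
        obtain ⟨h1, -, -, -, -, -, -, h8, h9, h10⟩ := hK _ (hFmem n hn)
        exact ⟨h1, h8, h9, h10⟩)
    have hFM : ∀ n ∈ F, n.1 ∈ Finset.Icc 1 M ∧ n.2 ∈ Finset.Icc 1 M := fun n hn => by
      obtain ⟨-, -, h3, h4, -⟩ := hK _ (hFmem n hn)
      exact ⟨h3, h4⟩
    refine (card_le_of_coloring F M hFM f _ hf ((differenceSet M w).filter
      (fun z => a ∣ E w z)) fun n hn n' hn' hne hnn' => ?_).trans ?_
    · obtain ⟨d1, d2, d3⟩ := hff n hn n' hn' hnn'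
      have b1 := hFM n hn
      have b2 := hFM n' hn'
      simp only [Finset.mem_Icc] at b1 b2
      simp only [differenceSet, Finset.mem_filter, Finset.mem_product, Finset.mem_Icc]
      refine ⟨⟨⟨⟨by omega, by omega⟩, by omega, by omega⟩, ?_, d1, d2⟩, d3⟩
      intro h0
      simp only [Prod.mk.injEq] at h0
      exact hne (Prod.ext (by omega) (by omega))
    · refine mul_le_mul_of_nonneg_right ?_ (add_nonneg zero_le_one
        (mul_nonneg (by positivity) (Finset.sum_nonneg fun z _ => hnn z)))
      have c1 := hTW w.1 (by omega) hw'.1.2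
      have c2 := hTW w.2 (by omega) hw'.2.2
      have c3 := hTA a.natAbs (by omega) (by omega)
      simp only [Finset.card_product]
      have : (w.1.divisors.card * w.1.divisors.card) * ((w.2.divisors.card * w.2.divisors.card) *
          (a.natAbs.divisors.card * a.natAbs.divisors.card)) ≤ (T * T) * ((T * T) * (T * T)) := by
        gcongr
      calc _ ≤ (((T * T) * ((T * T) * (T * T)) : ℕ) : ℝ) := by exact_mod_cast this
        _ = _ := by push_cast; ring
  have hnd1 : ((K.filter (fun k => ¬ deg k.2.1)).card : ℝ) ≤ ∑ t ∈ WN ×ˢ AA,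
      (T : ℝ) ^ 6 * (1 + 4 * (M : ℝ) ^ 2 * ∑ z ∈ (differenceSet M t.1).filter
        (fun z => t.2 ∣ E t.1 z), recipWeight z.1 * recipWeight z.2) := by
    rw [Finset.card_eq_sum_card_fiberwise (f := fun k => k.2) (t := WN ×ˢ AA)]
    · push_cast
      exact Finset.sum_le_sum hfib
    · intro k hk
      obtain ⟨hk, hkd⟩ := Finset.mem_filter.mp hk
      exact Finset.mem_product.mpr ⟨Finset.mem_filter.mpr ⟨hmemWW k hk, hkd⟩, hmemAA k hk⟩
  have hexch : ∑ t ∈ WN ×ˢ AA, ∑ z ∈ (differenceSet M t.1).filter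
        (fun z => t.2 ∣ E t.1 z), recipWeight z.1 * recipWeight z.2 ≤
      ∑ w ∈ WN, ∑ z ∈ differenceSet M w, 2 * T * (recipWeight z.1 * recipWeight z.2) := by
    rw [Finset.sum_product]
    refine Finset.sum_le_sum fun w hw => ?_
    simp only [Finset.sum_filter]
    rw [Finset.sum_comm]
    refine Finset.sum_le_sum fun z hz => ?_
    rw [← Finset.sum_filter, Finset.sum_const, nsmul_eq_mul]
    refine mul_le_mul_of_nonneg_right ?_ (hnn z)
    obtain ⟨hw1, hwd⟩ := Finset.mem_filter.mp hw
    rw [hWW, Finset.mem_product, Finset.mem_Icc, Finset.mem_Icc] at hw1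
    simp only [differenceSet, Finset.mem_filter, Finset.mem_product, Finset.mem_Icc] at hz
    have hE0 : E w z ≠ 0 := by
      intro h0
      have h1 : (w.2 : ℤ) ^ 2 * z.1 ^ 3 = (w.1 : ℤ) ^ 2 * z.2 ^ 3 := by
        simp only [hE] at h0
        have := (mul_eq_zero.mp h0).resolve_left (by norm_num)
        linarith
      exact hwd (exists_cube_eq_of_eq (by omega) (by omega) hz.2.1 h1)
    have hEle : (E w z).natAbs ≤ 8 * 2304 ^ 3 * M ^ 3 * W ^ 2 := by
      have b1 : |z.1| ≤ M := abs_le.mpr hz.1.1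
      have b2 : |z.2| ≤ M := abs_le.mpr hz.1.2
      have b3 : (w.1 : ℤ) ≤ W := by exact_mod_cast hw1.1.2
      have b4 : (w.2 : ℤ) ≤ W := by exact_mod_cast hw1.2.2
      have e1 : |(w.2 : ℤ) ^ 2 * z.1 ^ 3| ≤ W ^ 2 * M ^ 3 := by
        rw [abs_mul, abs_pow, abs_pow, Nat.abs_cast]; gcongr
      have e2 : |(w.1 : ℤ) ^ 2 * z.2 ^ 3| ≤ W ^ 2 * M ^ 3 := by
        rw [abs_mul, abs_pow, abs_pow, Nat.abs_cast]; gcongr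
      have e3 : |E w z| ≤ 8 * 2304 ^ 3 * M ^ 3 * W ^ 2 := by
        rw [abs_le] at e1 e2 ⊢
        simp only [hE]
        constructor <;> linarith
      rw [Int.abs_eq_natAbs] at e3
      exact_mod_cast e3
    have h2 := (card_int_divisors_le (AA.filter (fun a => a ∣ E w z)) _ hE0
      (fun a ha => (Finset.mem_filter.mp ha).2)).trans
      (Nat.mul_le_mul_left 2 (hTE _ (Int.natAbs_ne_zero.mpr hE0) hEle))
    exact_mod_cast h2
  set β : ℕ → ℝ := fun w => ∑ x ∈ (Finset.Icc (-(M : ℤ)) M).filter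
        (fun x => x ≠ 0 ∧ (w : ℤ) ∣ 2304 * x), recipWeight x with hβ
  have hβnn : ∀ w, 0 ≤ β w := fun w => Finset.sum_nonneg fun x _ => recipWeight_nonneg x
  have hβsum : ∑ w ∈ Finset.Icc 1 W, β w ≤ 2 * (T : ℝ) ^ 2 := sum_sum_recipWeight_le M W T hTM hH
  have hT1' : (1 : ℝ) ≤ T := by exact_mod_cast hT1
  have hW1' : (1 : ℝ) ≤ W := by exact_mod_cast hW
  have hA1' : (1 : ℝ) ≤ A := by exact_mod_cast hA
  have hwsum : ∑ w ∈ WN, ∑ z ∈ differenceSet M w, recipWeight z.1 * recipWeight z.2 ≤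
      8 * W * (T : ℝ) ^ 4 := by
    calc ∑ w ∈ WN, ∑ z ∈ differenceSet M w, recipWeight z.1 * recipWeight z.2
        ≤ ∑ w ∈ WW, ∑ z ∈ differenceSet M w, recipWeight z.1 * recipWeight z.2 :=
          Finset.sum_le_sum_of_subset_of_nonneg (Finset.filter_subset _ _)
            fun w _ _ => Finset.sum_nonneg fun z _ => hnn z
      _ ≤ ∑ w ∈ WW, (β w.1 + β w.2 + β w.1 * β w.2) :=
          Finset.sum_le_sum fun w _ => sum_differenceSet_le M w
      _ = 2 * W * (∑ w ∈ Finset.Icc 1 W, β w) + (∑ w ∈ Finset.Icc 1 W, β w) ^ 2 := by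
          rw [hWW, Finset.sum_product]
          simp only [Finset.sum_add_distrib, Finset.sum_const, Nat.card_Icc, Nat.add_sub_cancel,
            nsmul_eq_mul, ← Finset.mul_sum, ← Finset.sum_mul]
          ring
      _ ≤ 2 * W * (2 * (T : ℝ) ^ 2) + (2 * (T : ℝ) ^ 2) ^ 2 := by
          have : 0 ≤ ∑ w ∈ Finset.Icc 1 W, β w := Finset.sum_nonneg fun w _ => hβnn w
          gcongr
      _ ≤ 8 * W * (T : ℝ) ^ 4 := by
          have h1 : (T : ℝ) ^ 2 ≤ (T : ℝ) ^ 4 := pow_le_pow_right₀ hT1' (by norm_num)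
          have h2 : (W : ℝ) * T ^ 2 ≤ W * T ^ 4 := by gcongr
          have h3 : (T : ℝ) ^ 4 ≤ W * T ^ 4 := le_mul_of_one_le_left (by positivity) hW1'
          nlinarith
  have hcardt : (((WN ×ˢ AA).card : ℕ) : ℝ) ≤ 2 * (W : ℝ) ^ 2 * A := by
    have h1 : (WN ×ˢ AA).card ≤ (W * W) * (2 * A) := by
      rw [Finset.card_product]
      refine Nat.mul_le_mul ((Finset.card_filter_le _ _).trans (by simp [hWW])) ?_
      rw [hAA, Finset.card_erase_of_mem (Finset.mem_Icc.mpr ⟨by omega, by omega⟩), Int.card_Icc]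
      omega
    calc (((WN ×ˢ AA).card : ℕ) : ℝ) ≤ (((W * W) * (2 * A) : ℕ) : ℝ) := by exact_mod_cast h1
      _ = _ := by push_cast; ring
  have hnd2 : ((K.filter (fun k => ¬ deg k.2.1)).card : ℝ) ≤
      2 * (T : ℝ) ^ 6 * ((W : ℝ) ^ 2 * A) + 64 * (T : ℝ) ^ 11 * ((M : ℝ) ^ 2 * W) := by
    refine hnd1.trans ?_
    rw [← Finset.mul_sum, Finset.sum_add_distrib, Finset.sum_const, nsmul_eq_mul, mul_one,
      ← Finset.mul_sum]
    have h1 := hexch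
    simp only [← Finset.mul_sum] at h1
    calc (T : ℝ) ^ 6 * (((WN ×ˢ AA).card : ℕ) + 4 * (M : ℝ) ^ 2 * ∑ t ∈ WN ×ˢ AA,
          ∑ z ∈ (differenceSet M t.1).filter (fun z => t.2 ∣ E t.1 z),
            recipWeight z.1 * recipWeight z.2)
        ≤ (T : ℝ) ^ 6 * (2 * (W : ℝ) ^ 2 * A + 4 * (M : ℝ) ^ 2 * (2 * T * (8 * W * (T : ℝ) ^ 4))) := by
          gcongr
          exact h1.trans (by gcongr)
      _ = _ := by ring
  have hsplit := Finset.card_filter_add_card_filter_not (s := K) (fun k => deg k.2.1)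
  have hsplit' : (K.card : ℝ) = ((K.filter (fun k => deg k.2.1)).card : ℝ) +
      ((K.filter (fun k => ¬ deg k.2.1)).card : ℝ) := by exact_mod_cast hsplit.symm
  rw [hsplit']
  have h3 : (T : ℝ) ^ 3 * ((M : ℝ) ^ 2 * W) ≤ (T : ℝ) ^ 11 * ((M : ℝ) ^ 2 * W) := by
    gcongr
    · norm_num
  have h6 : (T : ℝ) ^ 6 * ((W : ℝ) ^ 2 * A) ≤ (T : ℝ) ^ 11 * ((W : ℝ) ^ 2 * A) := by
    gcongr
    · norm_num
  have h7 : 0 ≤ (T : ℝ) ^ 11 * ((W : ℝ) ^ 2 * A) := by positivity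
  linarith

/-- A squarefree number is determined by its class modulo squares. -/
theorem Squarefree.eq_of_mul_sq_eq {d d' h h' : ℕ} (hd : Squarefree d) (hd' : Squarefree d')
    (hh : h ≠ 0) (hh' : h' ≠ 0) (heq : d * h ^ 2 = d' * h' ^ 2) : d = d' := by
  have key : ∀ {d d' h h' : ℕ}, Squarefree d → Squarefree d' → h ≠ 0 → h' ≠ 0 →
      d * h ^ 2 = d' * h' ^ 2 → ∀ p, d.factorization p ≤ d'.factorization p := by
    intro d d' h h' hd hd' hh hh' heq p
    have h1 := congrArg (fun n => n.factorization p) heq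
    simp only [Nat.factorization_mul hd.ne_zero (pow_ne_zero 2 hh),
      Nat.factorization_mul hd'.ne_zero (pow_ne_zero 2 hh'), Nat.factorization_pow,
      Finsupp.add_apply, Finsupp.smul_apply, smul_eq_mul] at h1
    have h2 := hd.natFactorization_le_one p
    have h3 := hd'.natFactorization_le_one p
    omega
  exact Nat.eq_of_factorization_eq hd.ne_zero hd'.ne_zero fun p =>
    le_antisymm (key hd hd' hh hh' heq p) (key hd' hd hh' hh heq.symm p)

/-- A set of natural numbers in a short interval with highly divisible differences is small. -/
theorem card_le_of_dvd_sub (S : Finset ℕ) (L : ℝ) (hL : 0 ≤ L) (m : ℕ) (hm : m ≠ 0)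
    (hS : ∀ s ∈ S, ∀ t ∈ S, (s : ℝ) - t ≤ L ∧ (m : ℤ) ∣ 8 * ((s : ℤ) - t)) :
    (S.card : ℝ) ≤ 8 * L / m + 1 := by
  rcases S.eq_empty_or_nonempty with rfl | hne
  · simp; positivity
  have hm0 : (0 : ℝ) < m := by exact_mod_cast Nat.pos_of_ne_zero hm
  set t := S.min' hne with ht
  have htS : t ∈ S := S.min'_mem hne
  have hdvd : ∀ s ∈ S, ∃ k : ℕ, 8 * s = 8 * t + m * k := by
    intro s hs
    obtain ⟨k, hk⟩ := (hS s hs t htS).2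
    have hle : t ≤ s := S.min'_le s hs
    have hk0 : 0 ≤ k := by
      by_contra! hneg
      have : (m : ℤ) * k < 0 := mul_neg_of_pos_of_neg (by exact_mod_cast Nat.pos_of_ne_zero hm) hneg
      omega
    obtain ⟨j, rfl⟩ := Int.eq_ofNat_of_zero_le hk0
    refine ⟨j, ?_⟩
    have : (8 * s : ℤ) = 8 * t + m * j := by linarith
    exact_mod_cast this
  choose! k hk using hdvd
  have hcard : S.card ≤ (Finset.range (⌊8 * L / m⌋₊ + 1)).card := by
    refine Finset.card_le_card_of_injOn k (fun s hs => ?_) (fun s hs s' hs' hss => ?_)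
    · rw [Finset.mem_coe, Finset.mem_range, Nat.lt_succ_iff]
      refine Nat.le_floor ?_
      rw [le_div_iff₀ hm0]
      have h1 : (8 * s : ℝ) = 8 * t + m * k s := by exact_mod_cast hk s hs
      have h2 := (hS s hs t htS).1
      linarith
    · have h1 := hk s hs
      have h2 := hk s' hs'
      rw [hss] at h1
      omega
  rw [Finset.card_range] at hcard
  calc (S.card : ℝ) ≤ ((⌊8 * L / m⌋₊ + 1 : ℕ) : ℝ) := by exact_mod_cast hcard
    _ ≤ _ := by
      push_cast
      linarith [Nat.floor_le (a := 8 * L / m) (by positivity)]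

/-- The number of `u` with `4 n ^ 3 = u ^ 2 + d v ^ 2` for some `d ∈ [X, 2 X)`, for fixed
`n` and `v`. -/
theorem card_le_of_forall_exists (n v T : ℕ) (X : ℝ) (hv : v ≠ 0) (hvn : v.Coprime n)
    (hT : (v ^ 2).divisors.card ≤ T) (S : Finset ℕ)
    (hS : ∀ u ∈ S, ∃ d : ℕ, X ≤ d ∧ (d : ℝ) < 2 * X ∧ 4 * n ^ 3 = u ^ 2 + d * v ^ 2) :
    (S.card : ℝ) ≤ T * (8 * √X * (1 / v) + 1) := by
  classical
  rcases S.eq_empty_or_nonempty with rfl | ⟨u₀, hu₀⟩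
  · simp; positivity
  have hv0 : (0 : ℝ) < v := by exact_mod_cast Nat.pos_of_ne_zero hv
  have hv2 : v ^ 2 ≠ 0 := pow_ne_zero 2 hv
  have hcop : IsCoprime ((v ^ 2 : ℕ) : ℤ) ((n : ℤ) ^ 3) := by
    have : Nat.Coprime (v ^ 2) (n ^ 3) := Nat.Coprime.pow 2 3 hvn
    exact_mod_cast Nat.isCoprime_iff_coprime.mpr this
  have hmod : ∀ u ∈ S, ((v ^ 2 : ℕ) : ℤ) ∣ 4 * (n : ℤ) ^ 3 - u ^ 2 := by
    intro u hu
    obtain ⟨d, -, -, h⟩ := hS u hu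
    have h' : (4 * n ^ 3 : ℤ) = u ^ 2 + d * v ^ 2 := by exact_mod_cast h
    exact ⟨d, by push_cast; linear_combination h'⟩
  let e : ℕ → ℕ := fun u => Int.gcd ((v ^ 2 : ℕ) : ℤ) ((u : ℤ) - u₀)
  have hed : ∀ u ∈ S, e u ∈ (v ^ 2).divisors := by
    intro u _
    rw [Nat.mem_divisors]
    refine ⟨?_, hv2⟩
    have : (e u : ℤ) ∣ ((v ^ 2 : ℕ) : ℤ) := Int.gcd_dvd_left _ _
    exact Int.natCast_dvd_natCast.mp this
  have hfib : ∀ k ∈ (v ^ 2).divisors,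
      ((S.filter (fun u => e u = k)).card : ℝ) ≤ 8 * √X * (1 / v) + 1 := by
    intro k _
    have := card_le_of_dvd_sub (S.filter (fun u => e u = k)) (√X * v) (by positivity) (v ^ 2) hv2
      (by
        intro s hs t ht
        obtain ⟨hs, hse⟩ := Finset.mem_filter.mp hs
        obtain ⟨ht, hte⟩ := Finset.mem_filter.mp ht
        constructor
        · rcases le_or_gt (s : ℝ) t with hst | hst
          · have : 0 ≤ √X * v := by positivity
            linarith
          obtain ⟨d, hd1, hd2, hd⟩ := hS s hs
          obtain ⟨d', hd1', hd2', hd'⟩ := hS t ht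
          have hd : (4 * n ^ 3 : ℝ) = s ^ 2 + d * v ^ 2 := by exact_mod_cast hd
          have hd' : (4 * n ^ 3 : ℝ) = t ^ 2 + d' * v ^ 2 := by exact_mod_cast hd'
          have hX : 0 ≤ X := by linarith
          refine abs_le_of_sq_le_sq' ?_ (by positivity) |>.2
          rw [mul_pow, Real.sq_sqrt hX]
          have h1 : (d' - d : ℝ) * v ^ 2 ≤ X * v ^ 2 := by gcongr; linarith
          have ht0 : (0 : ℝ) ≤ t := by positivity
          nlinarith
        · set δ : ℤ := (s : ℤ) - t with hδ
          have key : ∀ u ∈ S, e u = k → ((v ^ 2 : ℕ) : ℤ) ∣ (k : ℤ) * (u + u₀) := by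
            intro u hu hue
            have h1 : ((v ^ 2 : ℕ) : ℤ) ∣ ((u : ℤ) - u₀) * (u + u₀) :=
              (dvd_sub (hmod u₀ hu₀) (hmod u hu)).trans (dvd_of_eq (by ring))
            have h2 := Int.dvd_gcd_mul_of_dvd_mul h1
            rwa [show Int.gcd ((v ^ 2 : ℕ) : ℤ) ((u : ℤ) - u₀) = k from hue] at h2
          have hks : (k : ℤ) ∣ (s : ℤ) - u₀ := hse ▸ Int.gcd_dvd_right _ _
          have hkt : (k : ℤ) ∣ (t : ℤ) - u₀ := hte ▸ Int.gcd_dvd_right _ _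
          have hkδ : (k : ℤ) ∣ δ := (dvd_sub hks hkt).trans (dvd_of_eq (by rw [hδ]; ring))
          have h1 : ((v ^ 2 : ℕ) : ℤ) ∣ k * δ :=
            (dvd_sub (key s hs hse) (key t ht hte)).trans (dvd_of_eq (by rw [hδ]; ring))
          have h2 : ((v ^ 2 : ℕ) : ℤ) ∣ δ * (s + u₀) :=
            (key s hs hse).trans (mul_dvd_mul_right hkδ _)
          have h3 : ((v ^ 2 : ℕ) : ℤ) ∣ (s - u₀) * δ := h1.trans (mul_dvd_mul_right hks _)
          have h4 : ((v ^ 2 : ℕ) : ℤ) ∣ (n : ℤ) ^ 3 * (8 * δ) :=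
            (dvd_add ((dvd_sub h2 h3).mul_right u₀) ((hmod u₀ hu₀).mul_right (2 * δ))).trans
              (dvd_of_eq (by ring))
          exact hcop.dvd_of_dvd_mul_left h4)
    refine this.trans (le_of_eq ?_)
    push_cast
    field_simp
  rw [Finset.card_eq_sum_card_fiberwise (f := e) (t := (v ^ 2).divisors) hed]
  push_cast
  refine (Finset.sum_le_card_nsmul _ _ _ hfib).trans ?_
  rw [nsmul_eq_mul]
  have : ((v ^ 2).divisors.card : ℝ) ≤ T := by exact_mod_cast hT
  exact mul_le_mul_of_nonneg_right this (by positivity)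

/-- `4 n ^ 3` is represented by `u ^ 2 + d v ^ 2` with `0 < v` coprime to `n`. -/
def RepresentsCube (d n : ℕ) : Prop :=
  ∃ u v : ℕ, 0 < v ∧ v.Coprime n ∧ 4 * n ^ 3 = u ^ 2 + d * v ^ 2

/-- For a fixed `n`, few `d ∈ [X, 2 X)` represent `4 n ^ 3`. -/
theorem card_representsCube_le (n W T : ℕ) (X : ℝ)
    (hT : ∀ m : ℕ, m ≠ 0 → m ≤ W ^ 2 → m.divisors.card ≤ T)
    (hH : ∑ x ∈ Finset.Icc 1 W, (1 / (x : ℝ)) ≤ T) (D : Finset ℕ)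
    (hD : ∀ d ∈ D, X ≤ d ∧ (d : ℝ) < 2 * X ∧ RepresentsCube d n)
    (hW : ∀ d ∈ D, ∀ u v : ℕ, 4 * n ^ 3 = u ^ 2 + d * v ^ 2 → v ≤ W) :
    (D.card : ℝ) ≤ T * (8 * √X * T + W) := by
  classical
  have hex : ∀ d ∈ D, ∃ uv : ℕ × ℕ, 0 < uv.2 ∧ uv.2.Coprime n ∧
      4 * n ^ 3 = uv.1 ^ 2 + d * uv.2 ^ 2 := by
    intro d hd
    obtain ⟨u, v, h⟩ := (hD d hd).2.2
    exact ⟨(u, v), h⟩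
  choose! g hg using hex
  rw [Finset.card_eq_sum_card_fiberwise (f := fun d => (g d).2) (t := Finset.Icc 1 W)
    (fun d hd => Finset.mem_coe.mpr (Finset.mem_Icc.mpr
      ⟨(hg d hd).1, hW d hd _ _ (hg d hd).2.2⟩))]
  push_cast
  have hfib : ∀ v ∈ Finset.Icc 1 W, ((D.filter (fun d => (g d).2 = v)).card : ℝ) ≤
      T * (8 * √X * (1 / v) + 1) := by
    intro v hv
    rw [Finset.mem_Icc] at hv
    rcases (D.filter (fun d => (g d).2 = v)).eq_empty_or_nonempty with h0 | ⟨d₀, hd₀⟩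
    · rw [h0]; simp; positivity
    have hvn : v.Coprime n := by
      obtain ⟨h1, h2⟩ := Finset.mem_filter.mp hd₀
      rw [← h2]; exact (hg d₀ h1).2.1
    have hinj : Set.InjOn (fun d => (g d).1) (D.filter (fun d => (g d).2 = v)) := by
      intro d hd d' hd' hdd
      obtain ⟨h1, h2⟩ := Finset.mem_filter.mp hd
      obtain ⟨h1', h2'⟩ := Finset.mem_filter.mp hd'
      have e1 := (hg d h1).2.2
      have e2 := (hg d' h1').2.2
      simp only at hdd
      rw [h2] at e1
      rw [h2', ← hdd] at e2
      have : d * v ^ 2 = d' * v ^ 2 := by omega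
      exact Nat.eq_of_mul_eq_mul_right (pow_pos hv.1 2) this
    rw [← Finset.card_image_of_injOn hinj]
    refine card_le_of_forall_exists n v T X (by omega) hvn
      (hT _ (pow_ne_zero 2 (by omega)) (Nat.pow_le_pow_left hv.2 2)) _ fun u hu => ?_
    obtain ⟨d, hd, rfl⟩ := Finset.mem_image.mp hu
    obtain ⟨h1, h2⟩ := Finset.mem_filter.mp hd
    have e1 := (hg d h1).2.2
    rw [h2] at e1
    exact ⟨d, (hD d h1).1, (hD d h1).2.1, e1⟩
  refine (Finset.sum_le_sum hfib).trans ?_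
  rw [← Finset.mul_sum, Finset.sum_add_distrib, ← Finset.mul_sum]
  simp only [Finset.sum_const, Nat.card_Icc, Nat.add_sub_cancel, nsmul_eq_mul, mul_one]
  gcongr

/-- The triples `(w₁, w₂, a)` in a box attached to `n₁, n₂`. -/
noncomputable def pairRepFiber (W A : ℕ) (n : ℕ × ℕ) : Finset ((ℕ × ℕ) × ℤ) :=
  open Classical in
  ((Finset.Icc 1 W ×ˢ Finset.Icc 1 W) ×ˢ Finset.Icc (-(A : ℤ)) A).filter
    (fun t => IsPairRep n.1 n.2 t.1.1 t.1.2 t.2)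

/-- Simultaneous representations of two different cubes are counted by triples `(w₁, w₂, a)`. -/
theorem card_le_card_pairRepFiber (n₁ n₂ W U : ℕ) (hn : n₁ ≠ n₂) (D : Finset ℕ)
    (hD : ∀ d ∈ D, Squarefree d ∧ RepresentsCube d n₁ ∧ RepresentsCube d n₂)
    (hW : ∀ d ∈ D, ∀ u v : ℕ, (4 * n₁ ^ 3 = u ^ 2 + d * v ^ 2 ∨ 4 * n₂ ^ 3 = u ^ 2 + d * v ^ 2) →
      v ≤ W ∧ u ≤ U) :
    D.card ≤ (pairRepFiber W (U * W) (n₁, n₂)).card := by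
  classical
  have hex : ∀ d ∈ D, ∃ t : (ℕ × ℕ) × ℤ, t ∈ pairRepFiber W (U * W) (n₁, n₂) ∧
      ∃ u₁ u₂ h : ℕ, h ≠ 0 ∧ 4 * n₁ ^ 3 = u₁ ^ 2 + (d * h ^ 2) * t.1.1 ^ 2 ∧
        4 * n₂ ^ 3 = u₂ ^ 2 + (d * h ^ 2) * t.1.2 ^ 2 ∧ t.2 = (u₁ : ℤ) * t.1.2 - u₂ * t.1.1 := by
    intro d hd
    obtain ⟨hsq, ⟨u₁, v₁, hv₁, hc₁, h₁⟩, u₂, v₂, hv₂, hc₂, h₂⟩ := hD d hd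
    obtain ⟨hvW₁, hu₁⟩ := hW d hd u₁ v₁ (Or.inl h₁)
    obtain ⟨hvW₂, hu₂⟩ := hW d hd u₂ v₂ (Or.inr h₂)
    obtain ⟨h, w₁, w₂, hh, hcop, e₁, e₂⟩ := Nat.exists_coprime' (Nat.gcd_pos_of_pos_left v₂ hv₁)
    have hw₁ : 0 < w₁ := Nat.pos_of_ne_zero (by rintro rfl; omega)
    have hw₂ : 0 < w₂ := Nat.pos_of_ne_zero (by rintro rfl; omega)
    have hw₁W : w₁ ≤ W := (Nat.le_mul_of_pos_right _ hh).trans (e₁ ▸ hvW₁)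
    have hw₂W : w₂ ≤ W := (Nat.le_mul_of_pos_right _ hh).trans (e₂ ▸ hvW₂)
    have h₁' : 4 * n₁ ^ 3 = u₁ ^ 2 + (d * h ^ 2) * w₁ ^ 2 := by rw [h₁, e₁]; ring
    have h₂' : 4 * n₂ ^ 3 = u₂ ^ 2 + (d * h ^ 2) * w₂ ^ 2 := by rw [h₂, e₂]; ring
    refine ⟨((w₁, w₂), (u₁ : ℤ) * w₂ - u₂ * w₁), ?_, u₁, u₂, h, hh.ne', h₁', h₂', rfl⟩
    simp only [pairRepFiber, Finset.mem_filter, Finset.mem_product, Finset.mem_Icc]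
    have b1 : (u₁ : ℤ) * w₂ ≤ U * W := by exact_mod_cast Nat.mul_le_mul hu₁ hw₂W
    have b2 : (u₂ : ℤ) * w₁ ≤ U * W := by exact_mod_cast Nat.mul_le_mul hu₂ hw₁W
    have b3 : 0 ≤ (u₁ : ℤ) * w₂ := by positivity
    have b4 : 0 ≤ (u₂ : ℤ) * w₁ := by positivity
    push_cast
    refine ⟨⟨⟨⟨hw₁, hw₁W⟩, hw₂, hw₂W⟩, by linarith, by linarith⟩, hw₁, hw₂, hcop, ?_, ?_,
      u₁, u₂, d * h ^ 2, h₁', h₂', rfl⟩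
    · exact Nat.Coprime.coprime_dvd_left ⟨h, e₁⟩ hc₁
    · exact Nat.Coprime.coprime_dvd_left ⟨h, e₂⟩ hc₂
  choose! g hg using hex
  refine Finset.card_le_card_of_injOn g (fun d hd => (hg d hd).1) fun d hd d' hd' hdd => ?_
  obtain ⟨hm, u₁, u₂, h, hh, e₁, e₂, e₃⟩ := hg d hd
  obtain ⟨-, u₁', u₂', h', hh', e₁', e₂', e₃'⟩ := hg d' hd'
  rw [← hdd] at e₁' e₂' e₃'
  have hrep : IsPairRep n₁ n₂ (g d).1.1 (g d).1.2 (g d).2 := (Finset.mem_filter.mp hm).2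
  have ha := hrep.ne_zero hn
  have hw₁ : (g d).1.1 ≠ 0 := hrep.1.ne'
  have hw₂ : ((g d).1.2 : ℤ) ≠ 0 := by exact_mod_cast hrep.2.1.ne'
  generalize (g d).1.1 = w₁ at *
  generalize (g d).1.2 = w₂ at *
  generalize (g d).2 = a at *
  have f₁ : (4 * n₁ ^ 3 : ℤ) = u₁ ^ 2 + (d * h ^ 2) * w₁ ^ 2 := by exact_mod_cast e₁
  have f₂ : (4 * n₂ ^ 3 : ℤ) = u₂ ^ 2 + (d * h ^ 2) * w₂ ^ 2 := by exact_mod_cast e₂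
  have f₁' : (4 * n₁ ^ 3 : ℤ) = u₁' ^ 2 + (d' * h' ^ 2) * w₁ ^ 2 := by exact_mod_cast e₁'
  have f₂' : (4 * n₂ ^ 3 : ℤ) = u₂' ^ 2 + (d' * h' ^ 2) * w₂ ^ 2 := by exact_mod_cast e₂'
  have hb : (u₁ : ℤ) * w₂ + u₂ * w₁ = u₁' * w₂ + u₂' * w₁ := by
    refine mul_left_cancel₀ ha ?_
    have l₁ : a * ((u₁ : ℤ) * w₂ + u₂ * w₁) = 4 * n₁ ^ 3 * w₂ ^ 2 - 4 * n₂ ^ 3 * w₁ ^ 2 := by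
      rw [e₃]; linear_combination (w₁ : ℤ) ^ 2 * f₂ - (w₂ : ℤ) ^ 2 * f₁
    have l₂ : a * ((u₁' : ℤ) * w₂ + u₂' * w₁) = 4 * n₁ ^ 3 * w₂ ^ 2 - 4 * n₂ ^ 3 * w₁ ^ 2 := by
      rw [e₃']; linear_combination (w₁ : ℤ) ^ 2 * f₂' - (w₂ : ℤ) ^ 2 * f₁'
    rw [l₁, l₂]
  have hu : (u₁ : ℤ) = u₁' := by
    refine mul_right_cancel₀ hw₂ ?_
    linarith
  have hu' : u₁ = u₁' := by exact_mod_cast hu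
  subst hu'
  have hdh : (d * h ^ 2) * w₁ ^ 2 = (d' * h' ^ 2) * w₁ ^ 2 := by omega
  exact (hD d hd).1.eq_of_mul_sq_eq (hD d' hd').1 hh hh'
    (Nat.eq_of_mul_eq_mul_right (by positivity) hdh)

theorem card_filter_mul_eq_le {𝓟 : Finset (ℕ × ℕ)} {n T : ℕ} (hn : n ≠ 0)
    (hT : n.divisors.card ≤ T) : (𝓟.filter (fun P => P.1 * P.2 = n)).card ≤ T := by
  refine (Finset.card_le_card_of_injOn Prod.fst (fun P hP => ?_) fun P hP Q hQ hPQ => ?_).trans hT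
  · exact Nat.mem_divisors.mpr ⟨⟨P.2, (Finset.mem_filter.mp hP).2.symm⟩, hn⟩
  · have h₁ := (Finset.mem_filter.mp hP).2
    have h₂ := (Finset.mem_filter.mp hQ).2
    rw [← hPQ] at h₂
    have h₀ : P.1 ≠ 0 := fun h => hn (by rw [← h₁, h, zero_mul])
    exact Prod.ext hPQ (mul_left_cancel₀ h₀ (h₁.trans h₂.symm))

/-- Few pairs of products of two primes have a common prime factor. -/
theorem card_filter_not_coprime_le (R : ℕ) (𝓟 : Finset (ℕ × ℕ))
    (h𝓟 : ∀ P ∈ 𝓟, P.1.Prime ∧ P.2.Prime ∧ P.1 < R ∧ P.2 < R) :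
    ((𝓟 ×ˢ 𝓟).filter (fun Q => ¬ (Q.1.1 * Q.1.2).Coprime (Q.2.1 * Q.2.2))).card ≤ 4 * R ^ 3 := by
  classical
  let g : (ℕ × ℕ × ℕ) × Bool × Bool → (ℕ × ℕ) × (ℕ × ℕ) := fun x =>
    (if x.2.1 then (x.1.1, x.1.2.1) else (x.1.2.1, x.1.1),
      if x.2.2 then (x.1.1, x.1.2.2) else (x.1.2.2, x.1.1))
  let S : Finset ((ℕ × ℕ × ℕ) × Bool × Bool) :=
    (Finset.range R ×ˢ Finset.range R ×ˢ Finset.range R) ×ˢ Finset.univ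
  have hS : S.card = 4 * R ^ 3 := by
    simp only [S, Finset.card_product, Finset.card_range, Finset.card_univ, Fintype.card_prod,
      Fintype.card_bool]
    ring
  rw [← hS]
  refine (Finset.card_le_card fun Q hQ => ?_).trans (Finset.card_image_le (f := g))
  obtain ⟨hQ, hc⟩ := Finset.mem_filter.mp hQ
  obtain ⟨hQ₁, hQ₂⟩ := Finset.mem_product.mp hQ
  obtain ⟨p₁, p₂, l₁, l₂⟩ := h𝓟 _ hQ₁
  obtain ⟨q₁, q₂, k₁, k₂⟩ := h𝓟 _ hQ₂
  obtain ⟨⟨a, b⟩, c, d⟩ := Q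
  simp only at *
  simp only [S, Finset.mem_image, Finset.mem_product, Finset.mem_range, Finset.mem_univ, and_true]
  rw [Nat.coprime_mul_iff_left, Nat.coprime_mul_iff_right, Nat.coprime_mul_iff_right,
    Nat.coprime_primes p₁ q₁, Nat.coprime_primes p₁ q₂, Nat.coprime_primes p₂ q₁,
    Nat.coprime_primes p₂ q₂] at hc
  by_cases h₁ : a = c
  · exact ⟨((a, b, d), true, true), ⟨l₁, l₂, k₂⟩, by simp [g, h₁]⟩
  by_cases h₂ : a = d
  · exact ⟨((a, b, c), true, false), ⟨l₁, l₂, k₁⟩, by simp [g, h₂]⟩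
  by_cases h₃ : b = c
  · exact ⟨((b, a, d), false, true), ⟨l₂, l₁, k₂⟩, by simp [g, h₃]⟩
  by_cases h₄ : b = d
  · exact ⟨((b, a, c), false, false), ⟨l₂, l₁, k₁⟩, by simp [g, h₄]⟩
  exact absurd ⟨⟨h₁, h₂⟩, h₃, h₄⟩ hc

theorem card_pairRepFiber_le (M W A T : ℕ)
    (hT : ∀ m : ℕ, m ≠ 0 → m ≤ 8 * M ^ 3 * W ^ 2 → m.divisors.card ≤ T) (n : ℕ × ℕ)
    (hn : n.1 ≠ n.2) (h₁ : n.1 ≤ M) (h₂ : n.2 ≤ M) :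
    (pairRepFiber W A n).card ≤ 2 * T * W ^ 2 := by
  classical
  have hinj : Function.Injective (fun t : (ℕ × ℕ) × ℤ => (n, t)) := fun s t h => (Prod.ext_iff.mp h).2
  rw [← Finset.card_image_of_injective _ hinj]
  refine (card_isPairRep_le_mul_card M W T hT _ fun k hk => ?_).trans
    (Nat.mul_le_mul_left _ ?_)
  · obtain ⟨t, ht, rfl⟩ := Finset.mem_image.mp hk
    simp only [pairRepFiber, Finset.mem_filter, Finset.mem_product, Finset.mem_Icc] at ht
    exact ⟨ht.2, hn, h₁, h₂, ht.1.1.1.2, ht.1.1.2.2⟩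
  · have hcard : ({n} ×ˢ (Finset.Icc 1 W ×ˢ Finset.Icc 1 W) : Finset _).card = W ^ 2 := by
      simp [sq]
    rw [← hcard]
    refine Finset.card_le_card fun x hx => ?_
    obtain ⟨k, hk, rfl⟩ := Finset.mem_image.mp hx
    obtain ⟨t, ht, rfl⟩ := Finset.mem_image.mp hk
    simp only [pairRepFiber, Finset.mem_filter, Finset.mem_product] at ht
    simp only [Finset.mem_product, Finset.mem_singleton, true_and]
    exact ht.1.1

theorem sum_card_pairRepFiber_le (M W A T : ℕ) (hW : 1 ≤ W) (hA : 1 ≤ A) (hT1 : 1 ≤ T)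
    (hM : 1 ≤ M)
    (hT : ∀ m : ℕ, m ≠ 0 → m ≤ 8 * 2304 ^ 3 * M ^ 3 * W ^ 3 * A → m.divisors.card ≤ T)
    (hH : ∑ x ∈ Finset.Icc 1 M, (1 / (x : ℝ)) ≤ T) (𝓢 : Finset (ℕ × ℕ))
    (h𝓢 : ∀ n ∈ 𝓢, n.1 ≠ n.2 ∧ n.1 ∈ Finset.Icc 1 M ∧ n.2 ∈ Finset.Icc 1 M ∧ Odd n.1 ∧ Odd n.2 ∧
      n.1.Coprime n.2) :
    ∑ n ∈ 𝓢, ((pairRepFiber W A n).card : ℝ) ≤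
      66 * (T : ℝ) ^ 11 * ((W : ℝ) ^ 2 * A + (M : ℝ) ^ 2 * W) := by
  classical
  let K : Finset ((ℕ × ℕ) × (ℕ × ℕ) × ℤ) :=
    (𝓢.sigma fun n => pairRepFiber W A n).map (Equiv.sigmaEquivProd _ _).toEmbedding
  have hK : ∑ n ∈ 𝓢, ((pairRepFiber W A n).card : ℝ) = K.card := by
    rw [Finset.card_map, Finset.card_sigma]
    push_cast
    rfl
  rw [hK]
  refine card_isPairRep_le M W A T hW hA hT1 hM hT hH K fun k hk => ?_
  obtain ⟨⟨n, t⟩, ht, rfl⟩ := Finset.mem_map.mp hk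
  obtain ⟨hn, ht⟩ := Finset.mem_sigma.mp ht
  obtain ⟨h₁, h₂, h₃, h₄, h₅, h₆⟩ := h𝓢 n hn
  simp only [pairRepFiber, Finset.mem_filter, Finset.mem_product] at ht
  exact ⟨ht.2, h₁, h₂, h₃, (Finset.mem_Icc.mp ht.1.1.1).2, (Finset.mem_Icc.mp ht.1.1.2).2, ht.1.2,
    h₄, h₅, h₆⟩

/-- The second moment bound in terms of a divisor bound `T`. -/
theorem sum_card_filter_representsCube_sq_le (R M W U T : ℕ) (X : ℝ) (hM : 1 ≤ M) (hW : 1 ≤ W)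
    (hU : 1 ≤ U) (hT1 : 1 ≤ T)
    (hT : ∀ m : ℕ, m ≠ 0 → m ≤ 8 * 2304 ^ 3 * M ^ 3 * W ^ 3 * (U * W) → m.divisors.card ≤ T)
    (hH : ∑ x ∈ Finset.Icc 1 M, (1 / (x : ℝ)) ≤ T)
    (hH' : ∑ x ∈ Finset.Icc 1 W, (1 / (x : ℝ)) ≤ T)
    (𝓟 : Finset (ℕ × ℕ))
    (h𝓟 : ∀ P ∈ 𝓟, P.1.Prime ∧ P.2.Prime ∧ P.1 < R ∧ P.2 < R ∧ Odd (P.1 * P.2) ∧ P.1 * P.2 ≤ M)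
    (D : Finset ℕ) (hD : ∀ d ∈ D, Squarefree d ∧ X ≤ d ∧ (d : ℝ) < 2 * X)
    (hDW : ∀ d ∈ D, ∀ P ∈ 𝓟, ∀ u v : ℕ, 4 * (P.1 * P.2) ^ 3 = u ^ 2 + d * v ^ 2 → v ≤ W ∧ u ≤ U)
    (r : ℕ → ℕ × ℕ → Prop) [∀ d P, Decidable (r d P)]
    (hr : ∀ d P, r d P → RepresentsCube d (P.1 * P.2)) :
    ∑ d ∈ D, ((𝓟.filter (r d)).card : ℝ) ^ 2 ≤
      (R : ℝ) ^ 2 * T ^ 2 * (8 * √X * T + W) + 8 * R ^ 3 * T * W ^ 2 +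
        66 * T ^ 13 * (W ^ 2 * (U * W) + M ^ 2 * W) := by
  classical
  let f : (ℕ × ℕ) × (ℕ × ℕ) → Finset ℕ := fun Q => D.filter (fun d => r d Q.1 ∧ r d Q.2)
  let N : (ℕ × ℕ) × (ℕ × ℕ) → ℕ × ℕ := fun Q => (Q.1.1 * Q.1.2, Q.2.1 * Q.2.2)
  have hU0 : 1 ≤ U * W := Nat.mul_pos hU hW
  have hTle : ∀ B, B ≤ 8 * 2304 ^ 3 * M ^ 3 * W ^ 3 * (U * W) →
      ∀ m : ℕ, m ≠ 0 → m ≤ B → m.divisors.card ≤ T := fun B hB m hm hmB => hT m hm (hmB.trans hB)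
  have hM3 : 1 ≤ M ^ 3 := Nat.one_le_pow _ _ hM
  have hM2 : 1 ≤ M ^ 2 := Nat.one_le_pow _ _ hM
  have hW3 : 1 ≤ W ^ 3 := Nat.one_le_pow _ _ hW
  have hBM : M ≤ 8 * 2304 ^ 3 * M ^ 3 * W ^ 3 * (U * W) :=
    calc M ≤ 8 * 2304 ^ 3 * M ^ 2 * W ^ 3 * (U * W) * M :=
          Nat.le_mul_of_pos_left _ (by positivity)
      _ = _ := by ring
  have hBW : W ^ 2 ≤ 8 * 2304 ^ 3 * M ^ 3 * W ^ 3 * (U * W) :=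
    calc W ^ 2 ≤ 8 * 2304 ^ 3 * M ^ 3 * (U * W) * W * W ^ 2 :=
          Nat.le_mul_of_pos_left _ (by positivity)
      _ = _ := by ring
  have hBK : 8 * M ^ 3 * W ^ 2 ≤ 8 * 2304 ^ 3 * M ^ 3 * W ^ 3 * (U * W) :=
    calc 8 * M ^ 3 * W ^ 2 ≤ 2304 ^ 3 * (U * W) * W * (8 * M ^ 3 * W ^ 2) :=
          Nat.le_mul_of_pos_left _ (by positivity)
      _ = _ := by ring
  have hN0 : ∀ P ∈ 𝓟, P.1 * P.2 ≠ 0 := fun P hP =>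
    mul_ne_zero (h𝓟 P hP).1.ne_zero (h𝓟 P hP).2.1.ne_zero
  have hfib : ∀ n, n ≠ 0 → n ≤ M → (𝓟.filter (fun P => P.1 * P.2 = n)).card ≤ T := fun n hn hnM =>
    card_filter_mul_eq_le hn (hTle M hBM n hn hnM)
  have hcardP : 𝓟.card ≤ R ^ 2 := by
    calc 𝓟.card ≤ (Finset.range R ×ˢ Finset.range R).card := Finset.card_le_card fun P hP => by
          simpa using ⟨(h𝓟 P hP).2.2.1, (h𝓟 P hP).2.2.2.1⟩
      _ = R ^ 2 := by simp [sq]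
  have hswap : ∑ d ∈ D, ((𝓟.filter (r d)).card : ℝ) ^ 2 = ∑ Q ∈ 𝓟 ×ˢ 𝓟, ((f Q).card : ℝ) := by
    have h := Finset.sum_card_bipartiteAbove_eq_sum_card_bipartiteBelow (s := D) (t := 𝓟 ×ˢ 𝓟)
      (fun d Q => r d Q.1 ∧ r d Q.2)
    have h' : ∀ d, (Finset.bipartiteAbove (fun d Q => r d Q.1 ∧ r d Q.2) (𝓟 ×ˢ 𝓟) d).card =
        (𝓟.filter (r d)).card ^ 2 := fun d => by
      rw [Finset.bipartiteAbove, Finset.filter_product, Finset.card_product, sq]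
    simp only [h'] at h
    exact_mod_cast h
  have hsame : ∀ Q ∈ 𝓟 ×ˢ 𝓟, ((f Q).card : ℝ) ≤ T * (8 * √X * T + W) := by
    intro Q hQ
    have hQ₁ := (Finset.mem_product.mp hQ).1
    refine card_representsCube_le (Q.1.1 * Q.1.2) W T X (hTle _ hBW) hH' (f Q) (fun d hd => ?_)
      fun d hd u v h => (hDW d (Finset.mem_filter.mp hd).1 _ hQ₁ u v h).1
    obtain ⟨h₁, h₂, -⟩ := Finset.mem_filter.mp hd
    exact ⟨(hD d h₁).2.1, (hD d h₁).2.2, hr d _ h₂⟩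
  have hdiff : ∀ Q ∈ 𝓟 ×ˢ 𝓟, (N Q).1 ≠ (N Q).2 →
      (f Q).card ≤ (pairRepFiber W (U * W) (N Q)).card := by
    intro Q hQ hne
    obtain ⟨hQ₁, hQ₂⟩ := Finset.mem_product.mp hQ
    refine card_le_card_pairRepFiber _ _ W U hne (f Q) (fun d hd => ?_) fun d hd u v h => ?_
    · obtain ⟨h₁, h₂, h₃⟩ := Finset.mem_filter.mp hd
      exact ⟨(hD d h₁).1, hr d _ h₂, hr d _ h₃⟩
    · have hd := (Finset.mem_filter.mp hd).1
      exact h.elim (hDW d hd _ hQ₁ u v) (hDW d hd _ hQ₂ u v)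
  have hX : 0 ≤ √X := Real.sqrt_nonneg X
  rw [hswap, ← Finset.sum_filter_add_sum_filter_not _ (fun Q => (N Q).1 = (N Q).2), add_assoc]
  refine add_le_add ?_ ?_
  · refine (Finset.sum_le_card_nsmul _ _ _ fun Q hQ => hsame Q (Finset.mem_filter.mp hQ).1).trans ?_
    rw [nsmul_eq_mul]
    have hc : ((𝓟 ×ˢ 𝓟).filter (fun Q => (N Q).1 = (N Q).2)).card ≤ T * 𝓟.card := by
      refine Finset.card_le_mul_card_image_of_maps_to (f := Prod.fst)
        (fun Q hQ => (Finset.mem_product.mp (Finset.mem_filter.mp hQ).1).1) T fun P hP => ?_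
      refine le_trans (Finset.card_le_card_of_injOn Prod.snd (fun Q hQ => ?_)
        fun Q hQ Q' hQ' h => ?_) (hfib (P.1 * P.2) (hN0 P hP) (h𝓟 P hP).2.2.2.2.2)
      · obtain ⟨hQ, he⟩ := Finset.mem_filter.mp hQ
        obtain ⟨hQ, h⟩ := Finset.mem_filter.mp hQ
        rw [← he]
        exact Finset.mem_coe.mpr (Finset.mem_filter.mpr ⟨(Finset.mem_product.mp hQ).2, h.symm⟩)
      · exact Prod.ext ((Finset.mem_filter.mp hQ).2.trans (Finset.mem_filter.mp hQ').2.symm) h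
    have hc' : (((𝓟 ×ˢ 𝓟).filter (fun Q => (N Q).1 = (N Q).2)).card : ℝ) ≤ T * R ^ 2 := by
      exact_mod_cast hc.trans (Nat.mul_le_mul_left T hcardP)
    calc _ ≤ (T * R ^ 2 : ℝ) * (T * (8 * √X * T + W)) := by gcongr
      _ = _ := by ring
  rw [← Finset.sum_filter_add_sum_filter_not _ (fun Q => ¬ (N Q).1.Coprime (N Q).2)]
  refine add_le_add ?_ ?_
  · have hc : ((((𝓟 ×ˢ 𝓟).filter (fun Q => ¬ (N Q).1 = (N Q).2)).filter
        (fun Q => ¬ (N Q).1.Coprime (N Q).2)).card : ℝ) ≤ 4 * R ^ 3 := by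
      refine le_trans (Nat.cast_le.mpr (Finset.card_le_card
        (Finset.filter_subset_filter _ (Finset.filter_subset _ _)))) ?_
      exact_mod_cast card_filter_not_coprime_le R 𝓟 fun P hP =>
        ⟨(h𝓟 P hP).1, (h𝓟 P hP).2.1, (h𝓟 P hP).2.2.1, (h𝓟 P hP).2.2.2.1⟩
    refine (Finset.sum_le_card_nsmul _ _ (2 * T * W ^ 2 : ℝ) fun Q hQ => ?_).trans ?_
    · obtain ⟨hQ, -⟩ := Finset.mem_filter.mp hQ
      obtain ⟨hQ, hne⟩ := Finset.mem_filter.mp hQ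
      obtain ⟨hQ₁, hQ₂⟩ := Finset.mem_product.mp hQ
      exact_mod_cast (hdiff Q hQ hne).trans (card_pairRepFiber_le M W (U * W) T (hTle _ hBK) (N Q)
        hne (h𝓟 _ hQ₁).2.2.2.2.2 (h𝓟 _ hQ₂).2.2.2.2.2)
    · rw [nsmul_eq_mul]
      calc _ ≤ (4 * R ^ 3 : ℝ) * (2 * T * W ^ 2) := by gcongr
        _ = _ := by ring
  · set S := ((𝓟 ×ˢ 𝓟).filter (fun Q => ¬ (N Q).1 = (N Q).2)).filter
      (fun Q => ¬ ¬ (N Q).1.Coprime (N Q).2) with hS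
    have hmem : ∀ Q ∈ S, Q.1 ∈ 𝓟 ∧ Q.2 ∈ 𝓟 ∧ (N Q).1 ≠ (N Q).2 ∧ (N Q).1.Coprime (N Q).2 := by
      intro Q hQ
      obtain ⟨hQ, hc⟩ := Finset.mem_filter.mp hQ
      obtain ⟨hQ, hne⟩ := Finset.mem_filter.mp hQ
      exact ⟨(Finset.mem_product.mp hQ).1, (Finset.mem_product.mp hQ).2, hne, not_not.mp hc⟩
    have hbound := sum_card_pairRepFiber_le M W (U * W) T hW hU0 hT1 hM hT hH (S.image N) (by
      intro n hn
      obtain ⟨Q, hQ, rfl⟩ := Finset.mem_image.mp hn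
      obtain ⟨h₁, h₂, h₃, h₄⟩ := hmem Q hQ
      exact ⟨h₃, Finset.mem_Icc.mpr ⟨Nat.pos_of_ne_zero (hN0 _ h₁), (h𝓟 _ h₁).2.2.2.2.2⟩,
        Finset.mem_Icc.mpr ⟨Nat.pos_of_ne_zero (hN0 _ h₂), (h𝓟 _ h₂).2.2.2.2.2⟩,
        (h𝓟 _ h₁).2.2.2.2.1, (h𝓟 _ h₂).2.2.2.2.1, h₄⟩)
    calc ∑ Q ∈ S, ((f Q).card : ℝ)
        ≤ ∑ Q ∈ S, ((pairRepFiber W (U * W) (N Q)).card : ℝ) := by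
          refine Finset.sum_le_sum fun Q hQ => ?_
          obtain ⟨h₁, h₂, h₃, -⟩ := hmem Q hQ
          exact_mod_cast hdiff Q (Finset.mem_product.mpr ⟨h₁, h₂⟩) h₃
      _ = ∑ n ∈ S.image N, ((S.filter (fun Q => N Q = n)).card : ℝ) *
            (pairRepFiber W (U * W) n).card := by
          rw [Finset.sum_comp (fun n => ((pairRepFiber W (U * W) n).card : ℝ)) N]
          simp only [nsmul_eq_mul]
      _ ≤ ∑ n ∈ S.image N, (T : ℝ) ^ 2 * (pairRepFiber W (U * W) n).card := by
          refine Finset.sum_le_sum fun n hn => mul_le_mul_of_nonneg_right ?_ (by positivity)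
          obtain ⟨Q₀, hQ₀, rfl⟩ := Finset.mem_image.mp hn
          obtain ⟨h₁, h₂, -, -⟩ := hmem Q₀ hQ₀
          have hsub : S.filter (fun Q => N Q = N Q₀) ⊆
              (𝓟.filter (fun P => P.1 * P.2 = (N Q₀).1)) ×ˢ
                (𝓟.filter (fun P => P.1 * P.2 = (N Q₀).2)) := by
            intro Q hQ
            obtain ⟨hQ, he⟩ := Finset.mem_filter.mp hQ
            obtain ⟨k₁, k₂, -, -⟩ := hmem Q hQ
            rw [Finset.mem_product, Finset.mem_filter, Finset.mem_filter]
            exact ⟨⟨k₁, congrArg Prod.fst he⟩, k₂, congrArg Prod.snd he⟩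
          have hc := (Finset.card_le_card hsub).trans_eq (Finset.card_product _ _)
          have hc' := hc.trans (Nat.mul_le_mul
            (hfib _ (hN0 _ h₁) (h𝓟 _ h₁).2.2.2.2.2) (hfib _ (hN0 _ h₂) (h𝓟 _ h₂).2.2.2.2.2))
          rw [sq]
          exact_mod_cast hc'
      _ = (T : ℝ) ^ 2 * ∑ n ∈ S.image N, ((pairRepFiber W (U * W) n).card : ℝ) := by
          rw [Finset.mul_sum]
      _ ≤ (T : ℝ) ^ 2 * (66 * (T : ℝ) ^ 11 *
            ((W : ℝ) ^ 2 * ((U * W : ℕ) : ℝ) + (M : ℝ) ^ 2 * W)) := by gcongr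
      _ = _ := by push_cast; ring

/-- A uniform bound for divisor functions and harmonic sums. -/
theorem exists_divisor_bound (η : ℝ) (hη : 0 < η) :
    ∃ C : ℝ, 1 ≤ C ∧ ∀ B : ℝ, 1 ≤ B → ∃ T : ℕ, 1 ≤ T ∧ (T : ℝ) ≤ C * B ^ η ∧
      (∀ m : ℕ, m ≠ 0 → (m : ℝ) ≤ B → m.divisors.card ≤ T) ∧
      ∀ N : ℕ, (N : ℝ) ≤ B → ∑ x ∈ Finset.Icc 1 N, (1 / (x : ℝ)) ≤ T := by
  obtain ⟨C, hC, h⟩ := exists_card_divisors_le_rpow η hη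
  have hη' : 0 < 1 / η := by positivity
  refine ⟨C + 2 + 1 / η, by linarith, fun B hB => ?_⟩
  have hBη : 1 ≤ B ^ η := Real.one_le_rpow hB hη.le
  set t : ℝ := (C + 1 + 1 / η) * B ^ η with ht
  have ht1 : 1 ≤ t := one_le_mul_of_one_le_of_one_le (by linarith) hBη
  refine ⟨⌈t⌉₊, Nat.one_le_ceil_iff.mpr (by linarith), ?_, fun m hm hmB => ?_, fun N hN => ?_⟩
  · have := (Nat.ceil_lt_add_one (by linarith : 0 ≤ t)).le
    rw [ht] at this ⊢
    linarith
  · have h1 : (m : ℝ) ^ η ≤ B ^ η := by gcongr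
    have h2 : (m.divisors.card : ℝ) ≤ t := by
      calc (m.divisors.card : ℝ) ≤ C * (m : ℝ) ^ η := h m hm
        _ ≤ C * B ^ η := by gcongr
        _ ≤ t := by rw [ht]; gcongr; linarith
    exact_mod_cast h2.trans (Nat.le_ceil t)
  · refine le_trans ?_ (Nat.le_ceil t)
    have h1 : ∑ x ∈ Finset.Icc 1 N, (1 / (x : ℝ)) = ((harmonic N : ℚ) : ℝ) := by
      rw [harmonic_eq_sum_Icc]
      push_cast
      simp
    have h2 : Real.log N ≤ (N : ℝ) ^ η / η := Real.log_le_rpow_div (by positivity) hη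
    have h3 : (N : ℝ) ^ η / η ≤ B ^ η / η := by gcongr
    have h4 : B ^ η / η = 1 / η * B ^ η := by ring
    have h5 : 0 ≤ C * B ^ η := by positivity
    rw [h1]
    linarith [harmonic_le_one_add_log N]

/-- The pairs of distinct primes counted by `Sg`, without the representation condition. -/
noncomputable def primePairs (Z : ℝ) : Finset (ℕ × ℕ) :=
  open Classical in
  (Finset.range ⌈2 * Z⌉₊ ×ˢ Finset.range ⌈2 * Z⌉₊).filter fun P =>
    P.1.Prime ∧ P.2.Prime ∧ Z ≤ P.1 ∧ Z ≤ P.2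

theorem mem_primePairs {Z : ℝ} {P : ℕ × ℕ} : P ∈ primePairs Z ↔
    P.1 < ⌈2 * Z⌉₊ ∧ P.2 < ⌈2 * Z⌉₊ ∧ P.1.Prime ∧ P.2.Prime ∧ Z ≤ P.1 ∧ Z ≤ P.2 := by
  simp [primePairs, and_assoc]

theorem card_primePairs_le (Z : ℝ) : (primePairs Z).card ≤ ⌈2 * Z⌉₊ ^ 2 := by
  refine (Finset.card_filter_le _ _).trans ?_
  simp [sq]

open Classical in
theorem Sg_three_le (d : ℕ) (Z : ℝ) :
    Sg 3 d Z ≤ ((primePairs Z).filter (fun P => RepresentsCube d (P.1 * P.2))).card := by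
  rw [Sg, ← Set.ncard_coe_finset]
  refine Set.ncard_le_ncard ?_ (Finset.finite_toSet _)
  rintro P ⟨hp, hq, -, h₁, h₂, h₃, h₄, u, v, -, hv, hc, h⟩
  rw [Finset.mem_coe, Finset.mem_filter, mem_primePairs]
  refine ⟨⟨Nat.lt_ceil.mpr h₂, Nat.lt_ceil.mpr h₄, hp, hq, h₁, h₃⟩, u.natAbs, v.natAbs,
    Int.natAbs_pos.mpr hv, ?_, ?_⟩
  · rwa [Int.gcd, Int.natAbs_mul, Int.natAbs_natCast, Int.natAbs_natCast] at hc
  · zify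
    rw [sq_abs, sq_abs]
    exact h

/-- The second moment bound for `64 < X` in terms of a divisor bound `T`. -/
theorem sum_Sg_three_sq_le (X Z : ℝ) (T : ℕ) (hX : 64 < X) (hXZ : X ^ ((1 : ℝ) / 6) ≤ Z)
    (hZX : Z ≤ X) (hT1 : 1 ≤ T)
    (hT : ∀ m : ℕ, m ≠ 0 → (m : ℝ) ≤ 8 * 2304 ^ 3 * 4 ^ 3 * 16 ^ 5 * X ^ 21 → m.divisors.card ≤ T)
    (hH : ∀ N : ℕ, (N : ℝ) ≤ 8 * 2304 ^ 3 * 4 ^ 3 * 16 ^ 5 * X ^ 21 →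
      ∑ x ∈ Finset.Icc 1 N, (1 / (x : ℝ)) ≤ T)
    (D : Finset ℕ) (hD : ∀ d ∈ D, Squarefree d ∧ X ≤ d ∧ (d : ℝ) < 2 * X) :
    ∑ d ∈ D, (Sg 3 d Z : ℝ) ^ 2 ≤
      5000000 * T ^ 13 * (Z ^ 2 * X ^ ((1 : ℝ) / 2) + Z ^ 12 * X ^ (-(3 : ℝ) / 2)) := by
  classical
  have hX0 : 0 < X := by linarith
  set s : ℝ := √X with hs
  have hs0 : 0 < s := Real.sqrt_pos.mpr hX0
  have hs2 : s ^ 2 = X := Real.sq_sqrt hX0.le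
  have hs1 : 1 ≤ s := by nlinarith
  have hZ2 : 2 < Z := by
    by_contra! h
    have : X ≤ 64 := by
      calc X = (X ^ ((1 : ℝ) / 6)) ^ 6 := by
            rw [← Real.rpow_natCast, ← Real.rpow_mul hX0.le]
            norm_num
        _ ≤ 2 ^ 6 := by gcongr; exact hXZ.trans h
        _ = 64 := by norm_num
    linarith
  have hZ0 : 0 < Z := by linarith
  have hsZ : s ≤ Z ^ 3 := by
    calc s = (X ^ ((1 : ℝ) / 6)) ^ 3 := by
          rw [← Real.rpow_natCast, ← Real.rpow_mul hX0.le, hs, Real.sqrt_eq_rpow]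
          norm_num
      _ ≤ Z ^ 3 := by gcongr
  set V : ℝ := Z ^ 3 / s with hV
  have hV1 : 1 ≤ V := (one_le_div hs0).mpr hsZ
  have hVZ : V ≤ Z ^ 3 := div_le_self (by positivity) hs1
  have hVs : V * s = Z ^ 3 := div_mul_cancel₀ _ hs0.ne'
  set R : ℕ := ⌈2 * Z⌉₊
  set M : ℕ := ⌊4 * Z ^ 2⌋₊
  set W : ℕ := ⌊16 * V⌋₊
  set U : ℕ := ⌊16 * Z ^ 3⌋₊
  have hR : (R : ℝ) ≤ 3 * Z := by linarith [Nat.ceil_lt_add_one (by positivity : 0 ≤ 2 * Z)]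
  have hM : (M : ℝ) ≤ 4 * Z ^ 2 := Nat.floor_le (by positivity)
  have hW : (W : ℝ) ≤ 16 * V := Nat.floor_le (by positivity)
  have hU : (U : ℝ) ≤ 16 * Z ^ 3 := Nat.floor_le (by positivity)
  have hZ1 : 1 ≤ Z := by linarith
  have hZ3 : 1 ≤ Z ^ 3 := one_le_pow₀ hZ1
  have hZ2' : 1 ≤ Z ^ 2 := one_le_pow₀ hZ1
  have hM1 : 1 ≤ M := Nat.le_floor (by push_cast; linarith)
  have hW1 : 1 ≤ W := Nat.le_floor (by push_cast; linarith)
  have hU1 : 1 ≤ U := Nat.le_floor (by push_cast; linarith)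
  have hZ21 : Z ^ 21 ≤ X ^ 21 := by gcongr
  have hbig : (8 * 2304 ^ 3 * M ^ 3 * W ^ 3 * (U * W) : ℝ) ≤
      8 * 2304 ^ 3 * 4 ^ 3 * 16 ^ 5 * X ^ 21 := by
    have hW' : (W : ℝ) ≤ 16 * Z ^ 3 := by linarith
    calc (8 * 2304 ^ 3 * M ^ 3 * W ^ 3 * (U * W) : ℝ)
        ≤ 8 * 2304 ^ 3 * (4 * Z ^ 2) ^ 3 * (16 * Z ^ 3) ^ 3 * ((16 * Z ^ 3) * (16 * Z ^ 3)) := by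
          gcongr
      _ = 8 * 2304 ^ 3 * 4 ^ 3 * 16 ^ 5 * Z ^ 21 := by ring
      _ ≤ _ := by gcongr
  have hsmall : ∀ k : ℕ, k ≤ 21 → 4 * 16 * Z ^ k ≤ 8 * 2304 ^ 3 * 4 ^ 3 * 16 ^ 5 * X ^ 21 := by
    intro k hk
    calc 4 * 16 * Z ^ k ≤ 8 * 2304 ^ 3 * 4 ^ 3 * 16 ^ 5 * Z ^ 21 := by
          gcongr ?_ * ?_
          · norm_num
          · exact pow_le_pow_right₀ hZ1 hk
      _ ≤ _ := by gcongr
  have hHM := hH M (by linarith [hsmall 2 (by norm_num)])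
  have hHW := hH W (by linarith [hsmall 3 (by norm_num)])
  have hn : ∀ P ∈ primePairs Z, ((P.1 * P.2 : ℕ) : ℝ) ≤ 4 * Z ^ 2 := by
    intro P hP
    obtain ⟨h₁, h₂, -⟩ := mem_primePairs.mp hP
    have h₁ := (Nat.lt_ceil.mp h₁).le
    have h₂ := (Nat.lt_ceil.mp h₂).le
    push_cast
    calc (P.1 * P.2 : ℝ) ≤ (2 * Z) * (2 * Z) := by gcongr
      _ = _ := by ring
  have hodd : ∀ p : ℕ, p.Prime → Z ≤ p → Odd p := fun p hp hZp =>
    hp.odd_of_ne_two (by rintro rfl; norm_num at hZp; linarith)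
  have hmain := sum_card_filter_representsCube_sq_le R M W U T X hM1 hW1 hU1 hT1
    (fun m hm hmB => hT m hm (le_trans (by exact_mod_cast hmB) hbig)) hHM hHW (primePairs Z)
    (fun P hP => by
      obtain ⟨h₁, h₂, h₃, h₄, h₅, h₆⟩ := mem_primePairs.mp hP
      exact ⟨h₃, h₄, h₁, h₂, (hodd _ h₃ h₅).mul (hodd _ h₄ h₆), Nat.le_floor (hn P hP)⟩)
    D hD
    (fun d hd P hP u v h => by
      have hn := hn P hP
      set n := P.1 * P.2
      have h' : (4 * n ^ 3 : ℝ) = u ^ 2 + d * v ^ 2 := by exact_mod_cast h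
      have hle : (4 * n ^ 3 : ℝ) ≤ (16 * Z ^ 3) ^ 2 := by
        calc (4 * n ^ 3 : ℝ) ≤ 4 * (4 * Z ^ 2) ^ 3 := by gcongr
          _ = _ := by ring
      have hXd := (hD d hd).2.1
      have hXv : X * v ^ 2 ≤ d * v ^ 2 := by gcongr
      constructor
      · refine Nat.le_floor ?_
        rw [hV, ← mul_div_assoc, le_div_iff₀ hs0]
        refine le_of_sq_le_sq ?_ (by positivity)
        rw [mul_pow, hs2]
        nlinarith [sq_nonneg (u : ℝ)]
      · refine Nat.le_floor (le_of_sq_le_sq ?_ (by positivity))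
        have : 0 ≤ (d * v ^ 2 : ℝ) := by positivity
        linarith)
    (fun d P => RepresentsCube d (P.1 * P.2)) (fun _ _ h => h)
  have hsum : ∑ d ∈ D, (Sg 3 d Z : ℝ) ^ 2 ≤
      ∑ d ∈ D, (((primePairs Z).filter (fun P => RepresentsCube d (P.1 * P.2))).card : ℝ) ^ 2 := by
    refine Finset.sum_le_sum fun d _ => ?_
    gcongr
    exact Sg_three_le d Z
  refine (hsum.trans hmain).trans ?_
  have hE : Z ^ 2 * X ^ ((1 : ℝ) / 2) + Z ^ 12 * X ^ (-(3 : ℝ) / 2) = Z ^ 2 * s + Z ^ 3 * V ^ 3 := by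
    have h1 : X ^ ((1 : ℝ) / 2) = s := (Real.sqrt_eq_rpow X).symm
    have h2 : X ^ (-(3 : ℝ) / 2) = (s ^ 3)⁻¹ := by
      rw [← h1, ← Real.rpow_natCast, ← Real.rpow_mul hX0.le, ← Real.rpow_neg hX0.le]
      norm_num
    rw [h1, h2, hV]
    field_simp
  rw [hE]
  have hT1' : (1 : ℝ) ≤ T := by exact_mod_cast hT1
  set t : ℝ := (T : ℝ) with ht
  have ht13 : ∀ k : ℕ, k ≤ 13 → t ^ k ≤ t ^ 13 := fun k hk => pow_le_pow_right₀ hT1' hk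
  set E : ℝ := Z ^ 2 * s + Z ^ 3 * V ^ 3 with hEdef
  have e₁ : Z ^ 2 * s ≤ E := by rw [hEdef]; linarith [show 0 ≤ Z ^ 3 * V ^ 3 by positivity]
  have e₂ : Z ^ 3 * V ^ 3 ≤ E := by rw [hEdef]; linarith [show 0 ≤ Z ^ 2 * s by positivity]
  have e₃ : Z ^ 2 * V ≤ E := le_trans (mul_le_mul (pow_le_pow_right₀ hZ1 (by norm_num))
    (le_self_pow₀ hV1 (by norm_num)) (by positivity) (by positivity)) e₂
  have e₄ : Z ^ 3 * V ^ 2 ≤ E := le_trans (mul_le_mul_of_nonneg_left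
    (pow_le_pow_right₀ hV1 (by norm_num)) (by positivity)) e₂
  have e₅ : Z ^ 4 * V ≤ E := by
    refine le_of_sq_le_sq ?_ (by positivity)
    calc (Z ^ 4 * V) ^ 2 = (Z ^ 2 * s) * (Z ^ 3 * V ^ 3) := by
          linear_combination (-(Z ^ 5 * V ^ 2)) * hVs
      _ ≤ E * E := by gcongr
      _ = E ^ 2 := by ring
  calc (R : ℝ) ^ 2 * t ^ 2 * (8 * s * t + W) + 8 * R ^ 3 * t * W ^ 2 +
        66 * t ^ 13 * (W ^ 2 * (U * W) + M ^ 2 * W)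
      ≤ (3 * Z) ^ 2 * t ^ 2 * (8 * s * t + 16 * V) + 8 * (3 * Z) ^ 3 * t * (16 * V) ^ 2 +
        66 * t ^ 13 * ((16 * V) ^ 2 * ((16 * Z ^ 3) * (16 * V)) + (4 * Z ^ 2) ^ 2 * (16 * V)) := by
        gcongr
    _ = t ^ 3 * (72 * (Z ^ 2 * s)) + t ^ 2 * (144 * (Z ^ 2 * V)) +
        t ^ 1 * (55296 * (Z ^ 3 * V ^ 2)) + t ^ 13 * (4325376 * (Z ^ 3 * V ^ 3)) +
        t ^ 13 * (16896 * (Z ^ 4 * V)) := by ring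
    _ ≤ t ^ 13 * (72 * E) + t ^ 13 * (144 * E) + t ^ 13 * (55296 * E) + t ^ 13 * (4325376 * E) +
        t ^ 13 * (16896 * E) := by
        have := ht13 3 (by norm_num)
        have := ht13 2 (by norm_num)
        have := ht13 1 (by norm_num)
        gcongr
    _ ≤ 5000000 * t ^ 13 * E := by
        have : 0 ≤ t ^ 13 * E := by positivity
        linarith

/-- For every `ε > 0` there is `C = C(ε)` such that for all `X ≥ 2` and all `Z`
with `X^(1/6) ≤ Z ≤ X`,
`∑_{X ≤ d < 2X, d squarefree} S_3(d;Z)² ≤ C·X^ε·(Z²X^(1/2) + Z^12·X^(-3/2))`. -/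
theorem second_moment_S3_bound (ε : ℝ) (hε : 0 < ε) :
    ∃ C : ℝ, 0 < C ∧ ∀ X Z : ℝ, 2 ≤ X →
      X ^ ((1 : ℝ) / 6) ≤ Z → Z ≤ X →
      ∑ d ∈ (Finset.range (⌈2 * X⌉₊ + 1)).filter
          (fun d : ℕ => Squarefree d ∧ X ≤ (d : ℝ) ∧ (d : ℝ) < 2 * X),
        (Sg 3 d Z : ℝ) ^ 2
      ≤ C * X ^ ε * (Z ^ 2 * X ^ ((1 : ℝ) / 2) + Z ^ 12 * X ^ (-(3 : ℝ) / 2)) := by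
  obtain ⟨C, hC, hbound⟩ := exists_divisor_bound (ε / 273) (by positivity)
  set c : ℝ := 8 * 2304 ^ 3 * 4 ^ 3 * 16 ^ 5 with hc
  have hc1 : 1 ≤ c := by rw [hc]; norm_num
  set K : ℝ := 5000000 * (C * c ^ (ε / 273)) ^ 13 with hK
  have hK0 : 0 ≤ K := by positivity
  refine ⟨K + 130 * (128 ^ 2) ^ 2, by positivity, fun X Z hX hXZ hZX => ?_⟩
  have hX0 : 0 < X := by linarith
  have hX1 : 1 ≤ X := by linarith
  have hXε : 1 ≤ X ^ ε := Real.one_le_rpow hX1 hε.le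
  have hZ1 : 1 ≤ Z := (Real.one_le_rpow hX1 (by norm_num)).trans hXZ
  set E : ℝ := Z ^ 2 * X ^ ((1 : ℝ) / 2) + Z ^ 12 * X ^ (-(3 : ℝ) / 2) with hE
  have hE1 : 1 ≤ E := by
    have h1 : 1 ≤ Z ^ 2 * X ^ ((1 : ℝ) / 2) :=
      one_le_mul_of_one_le_of_one_le (one_le_pow₀ hZ1) (Real.one_le_rpow hX1 (by norm_num))
    have h2 : 0 ≤ Z ^ 12 * X ^ (-(3 : ℝ) / 2) := by positivity
    linarith
  have hXE : 1 ≤ X ^ ε * E := one_le_mul_of_one_le_of_one_le hXε hE1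
  rw [mul_assoc]
  rcases le_or_gt X 64 with h64 | h64
  · have hR : ⌈2 * Z⌉₊ ≤ 128 := Nat.ceil_le.mpr (by push_cast; linarith)
    have hR' : ⌈2 * X⌉₊ ≤ 128 := Nat.ceil_le.mpr (by push_cast; linarith)
    have hSg : ∀ d, (Sg 3 d Z : ℝ) ≤ 128 ^ 2 := fun d => by
      classical
      exact_mod_cast ((Sg_three_le d Z).trans (Finset.card_filter_le _ _)).trans
        ((card_primePairs_le Z).trans (Nat.pow_le_pow_left hR 2))
    have hcard : ((Finset.range (⌈2 * X⌉₊ + 1)).filter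
        (fun d : ℕ => Squarefree d ∧ X ≤ (d : ℝ) ∧ (d : ℝ) < 2 * X)).card ≤ 130 := by
      refine (Finset.card_filter_le _ _).trans ?_
      rw [Finset.card_range]
      omega
    calc _ ≤ _ := Finset.sum_le_card_nsmul _ _ (((128 : ℝ) ^ 2) ^ 2) fun d _ => by
          gcongr
          exact hSg d
      _ ≤ 130 * (128 ^ 2) ^ 2 := by
          rw [nsmul_eq_mul]
          gcongr
          exact_mod_cast hcard
      _ ≤ (K + 130 * (128 ^ 2) ^ 2) * 1 := by linarith
      _ ≤ _ := by gcongr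
  · obtain ⟨T, hT1, hTle, hT, hH⟩ := hbound (c * X ^ 21)
      (one_le_mul_of_one_le_of_one_le hc1 (one_le_pow₀ hX1))
    have hT13 : (T : ℝ) ^ 13 ≤ (C * c ^ (ε / 273)) ^ 13 * X ^ ε := by
      calc (T : ℝ) ^ 13 ≤ (C * (c * X ^ 21) ^ (ε / 273)) ^ 13 := by gcongr
        _ = (C * c ^ (ε / 273)) ^ 13 * ((X ^ 21) ^ (ε / 273)) ^ 13 := by
            rw [Real.mul_rpow (by positivity) (by positivity)]
            ring
        _ = _ := by
            congr 1
            rw [← Real.rpow_natCast X, ← Real.rpow_mul hX0.le, ← Real.rpow_natCast,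
              ← Real.rpow_mul hX0.le]
            congr 1
            push_cast
            ring
    calc _ ≤ 5000000 * (T : ℝ) ^ 13 * E :=
          sum_Sg_three_sq_le X Z T h64 hXZ hZX hT1 hT hH _ fun d hd => (Finset.mem_filter.mp hd).2
      _ ≤ 5000000 * ((C * c ^ (ε / 273)) ^ 13 * X ^ ε) * E := by gcongr
      _ = K * (X ^ ε * E) := by rw [hK]; ring
      _ ≤ _ := by
          gcongr
          linarith
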